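/- Rearrangement inequality for random walks (continuous case, pointwise): Let φ : ℝ^d → [0,∞) be a probability density (measurable with ∫_{ℝ^d} φ = 1) vanishing at infinity, let f₁,…,f_m : ℝ^d → [0,∞) be continuous functions vanishing at infinity, and let 0 ≤ k₁ ≤ ⋯ ≤ k_m be integers with k_m ≥ 1. Then for every x₀ ∈ ℝ^d, ∫_{(ℝ^d)^{k_m}} ∏_{i=1}^m f_i(x₀ + x₁ + ⋯ + x_{k_i}) ∏_{j=1}^{k_m} φ(x_j) dx₁⋯dx_{k_m} ≤ ∫_{(ℝ^d)^{k_m}} ∏_{i=1}^m f_i*(x₁ + ⋯ + x_{k_i}) ∏_{j=1}^{k_m} φ*(x_j) dx₁⋯dx_{k_m}, where an empty sum of the x_j's is understood to be 0 and both integrals are taken in [0,∞]. -/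

import Mathlib

open MeasureTheory ENNReal Filter Topology
open scoped RealInnerProductSpace

/-- A nonnegative function on `ℝ^d` vanishes at infinity if all its positive
super-level sets have finite Lebesgue measure. -/
def VanishesAtInfinity {d : ℕ} (f : EuclideanSpace ℝ (Fin d) → ℝ) : Prop :=
  ∀ t : ℝ, 0 < t → volume {x : EuclideanSpace ℝ (Fin d) | t < f x} < ⊤

/-- Radius of the ball centered at the origin having the same volume as `A`. -/
noncomputable def symmRadius {d : ℕ} (A : Set (EuclideanSpace ℝ (Fin d))) : ℝ :=
  ((volume A / volume (Metric.ball (0 : EuclideanSpace ℝ (Fin d)) 1)).toReal) ^ ((1 : ℝ) / d)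

/-- `A*`: the open ball centered at the origin with the same Lebesgue measure as `A`. -/
noncomputable def ballStar {d : ℕ} (A : Set (EuclideanSpace ℝ (Fin d))) :
    Set (EuclideanSpace ℝ (Fin d)) :=
  Metric.ball 0 (symmRadius A)

/-- Symmetric decreasing rearrangement `f*` (with values in `[0,∞]`):
`f*(x) = ∫₀^∞ 1_{{f>t}*}(x) dt`. -/
noncomputable def symmRearrange {d : ℕ} (f : EuclideanSpace ℝ (Fin d) → ℝ)
    (x : EuclideanSpace ℝ (Fin d)) : ℝ≥0∞ :=
  ∫⁻ t in Set.Ioi (0 : ℝ), (ballStar {y | t < f y}).indicator (fun _ => (1 : ℝ≥0∞)) x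

/-- `x₁ + ⋯ + x_n` for a configuration `x` (indices shifted by one: `x j` is `x_{j+1}`);
an empty sum is `0`. -/
noncomputable def partialSum {d K : ℕ} (x : Fin K → EuclideanSpace ℝ (Fin d)) (n : ℕ) :
    EuclideanSpace ℝ (Fin d) :=
  ∑ j : Fin K, if (j : ℕ) < n then x j else 0

theorem exists_measure_Iio_eq (ν : Measure ℝ) [IsFiniteMeasure ν] [NullSingletonClass ν] {t : ℝ≥0∞}
    (ht0 : 0 < t) (ht : t < ν Set.univ) : ∃ x, ν (Set.Iio x) = t := by
  have hcont : Continuous fun x => ν (Set.Iic x) := by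
    have h := intervalIntegral.continuous_primitive (μ := ν) (f := fun _ => (1 : ℝ))
      (fun a b => by simp) 0
    have h2 : ∀ x, ν (Set.Iic x)
        = ENNReal.ofReal ((∫ _ in (0 : ℝ)..x, (1 : ℝ) ∂ν) + (ν (Set.Iic 0)).toReal) := by
      intro x
      have h3 : ∀ y, ∫ _ in Set.Iic y, (1 : ℝ) ∂ν = (ν (Set.Iic y)).toReal := fun y => by
        rw [setIntegral_const, smul_eq_mul, mul_one, Measure.real]
      rw [← intervalIntegral.integral_Iic_sub_Iic (integrable_const _) (integrable_const _),
        h3, h3, sub_add_cancel, ENNReal.ofReal_toReal (measure_ne_top _ _)]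
    exact (ENNReal.continuous_ofReal.comp (h.add continuous_const)).congr fun x => (h2 x).symm
  have hbot : Tendsto (fun x => ν (Set.Iic x)) atBot (𝓝 0) := by
    have := tendsto_measure_iInter_atBot (μ := ν) (s := fun x : ℝ => Set.Iic x)
      (fun _ => measurableSet_Iic.nullMeasurableSet) (fun a b h => Set.Iic_subset_Iic.2 h)
      ⟨0, measure_ne_top _ _⟩
    rwa [iInter_Iic_eq_empty_iff.2 (by simp), measure_empty] at this
  have htop : Tendsto (fun x => ν (Set.Iic x)) atTop (𝓝 (ν Set.univ)) := tendsto_measure_Iic_atTop ν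
  obtain ⟨x, hx⟩ := mem_range_of_exists_le_of_exists_ge (c := t) hcont
    ((hbot.eventually_lt_const ht0).exists.imp fun _ h => h.le)
    ((htop.eventually_const_lt ht).exists.imp fun _ h => h.le)
  exact ⟨x, (measure_congr Iio_ae_eq_Iic).trans hx⟩

theorem exists_volume_inter_Iio_eq {A : Set ℝ} (hA : volume A < ∞) {t : ℝ≥0∞}
    (ht0 : 0 < t) (ht : t < volume A) :
    ∃ x, volume (A ∩ Set.Iio x) = t ∧ volume (A ∩ Set.Ici x) = volume A - t := by
  have : IsFiniteMeasure (volume.restrict A) := ⟨by simpa using hA⟩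
  obtain ⟨x, hx⟩ := exists_measure_Iio_eq (volume.restrict A) ht0 (by simpa using ht)
  rw [Measure.restrict_apply measurableSet_Iio, Set.inter_comm] at hx
  refine ⟨x, hx, ?_⟩
  have h := measure_inter_add_sdiff (μ := volume) A (measurableSet_Iio (a := x))
  rw [hx, Set.sdiff_eq, Set.compl_Iio] at h
  rw [← h, ENNReal.add_sub_cancel_left (ht.trans hA).ne]

/-- The measure of `{(x, y) | x ∈ A, y ∈ B, x + y ∈ C}`. -/
noncomputable def tripleConv {G : Type*} [Add G] [MeasurableSpace G] (μ : Measure G)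
    (A B C : Set G) : ℝ≥0∞ :=
  ∫⁻ x, ∫⁻ y, A.indicator 1 x * B.indicator 1 y * C.indicator 1 (x + y) ∂μ ∂μ

theorem measurable_indicator_one' {G : Type*} [MeasurableSpace G] {A : Set G}
    (hA : MeasurableSet A) : Measurable (A.indicator (1 : G → ℝ≥0∞)) :=
  measurable_one.indicator hA

section Add

variable {G : Type*} [AddCommMonoid G] [MeasurableSpace G] {μ : Measure G}

theorem tripleConv_le_mul_left (A B C : Set G) (hA : MeasurableSet A) (hB : MeasurableSet B) :
    tripleConv μ A B C ≤ μ A * μ B := by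
  calc tripleConv μ A B C ≤ ∫⁻ x, ∫⁻ y, A.indicator 1 x * B.indicator 1 y ∂μ ∂μ := by
        refine lintegral_mono fun x => lintegral_mono fun y => ?_
        refine mul_le_of_le_one_right' ?_
        exact Set.indicator_le_self' (by simp) _
    _ = μ A * μ B := by
        simp_rw [lintegral_const_mul _ (measurable_indicator_one' hB)]
        rw [lintegral_mul_const _ (measurable_indicator_one' hA)]
        simp [hA, hB]

theorem tripleConv_mono {A B C A' B' C' : Set G} (hA : A ⊆ A') (hB : B ⊆ B') (hC : C ⊆ C') :
    tripleConv μ A B C ≤ tripleConv μ A' B' C' := by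
  refine lintegral_mono fun x => lintegral_mono fun y => ?_
  gcongr

variable [MeasurableAdd₂ G]

theorem measurable_tripleConv_integrand {A B C : Set G} (hA : MeasurableSet A)
    (hB : MeasurableSet B) (hC : MeasurableSet C) :
    Measurable (Function.uncurry fun x y : G =>
      (A.indicator 1 x * B.indicator 1 y * C.indicator 1 (x + y) : ℝ≥0∞)) :=
  (((measurable_indicator_one' hA).comp measurable_fst).mul
    ((measurable_indicator_one' hB).comp measurable_snd)).mul
    ((measurable_indicator_one' hC).comp measurable_add)

theorem tripleConv_comm [SFinite μ] {A B C : Set G} (hA : MeasurableSet A)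
    (hB : MeasurableSet B) (hC : MeasurableSet C) :
    tripleConv μ A B C = tripleConv μ B A C := by
  rw [tripleConv, lintegral_lintegral_swap (measurable_tripleConv_integrand hA hB hC).aemeasurable]
  refine lintegral_congr fun x => lintegral_congr fun z => ?_
  rw [add_comm z x]; ring

end Add

section Group

variable {G : Type*} [AddCommGroup G] [MeasurableSpace G] [MeasurableAdd₂ G] [MeasurableNeg G]
  {μ : Measure G} [SFinite μ] [μ.IsAddLeftInvariant] [μ.IsNegInvariant]

omit [μ.IsNegInvariant] in
theorem lintegral_lintegral_sub_swap {F : G → G → ℝ≥0∞} (hF : Measurable (Function.uncurry F)) :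
    ∫⁻ x, ∫⁻ y, F x y ∂μ ∂μ = ∫⁻ z, ∫⁻ x, F x (z - x) ∂μ ∂μ := by
  calc ∫⁻ x, ∫⁻ y, F x y ∂μ ∂μ = ∫⁻ x, ∫⁻ z, F x (z - x) ∂μ ∂μ :=
        lintegral_congr fun x => (lintegral_sub_right_eq_self (fun y => F x y) x).symm
    _ = _ := lintegral_lintegral_swap (Measurable.aemeasurable
        (hF.comp (measurable_fst.prodMk (measurable_snd.sub measurable_fst))))

omit [μ.IsNegInvariant] in
theorem tripleConv_eq_lintegral_sum {A B C : Set G} (hA : MeasurableSet A)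
    (hB : MeasurableSet B) (hC : MeasurableSet C) :
    tripleConv μ A B C =
      ∫⁻ z, ∫⁻ x, A.indicator 1 x * B.indicator 1 (z - x) * C.indicator 1 z ∂μ ∂μ := by
  rw [tripleConv, lintegral_lintegral_sub_swap (measurable_tripleConv_integrand hA hB hC)]
  simp

omit [SFinite μ] in
theorem tripleConv_swap (A B C : Set G) :
    tripleConv μ A B C = tripleConv μ (Neg.neg ⁻¹' A) C B := by
  have h1 : tripleConv μ A B C
      = ∫⁻ x, ∫⁻ z, A.indicator 1 x * B.indicator 1 (z - x) * C.indicator 1 z ∂μ ∂μ := by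
    refine lintegral_congr fun x => ?_
    rw [← lintegral_sub_right_eq_self _ x]
    simp
  rw [h1, tripleConv, ← lintegral_neg_eq_self]
  refine lintegral_congr fun x => lintegral_congr fun z => ?_
  have : (Neg.neg ⁻¹' A).indicator (1 : G → ℝ≥0∞) x = A.indicator 1 (-x) := rfl
  rw [this, sub_neg_eq_add, add_comm z x]
  ring

end Group

theorem tripleConv_eq_mul {G : Type*} [AddCommMonoid G] [MeasurableSpace G] {μ : Measure G}
    {A B C : Set G} (hA : MeasurableSet A) (hB : MeasurableSet B)
    (h : ∀ x ∈ A, ∀ y ∈ B, x + y ∈ C) : tripleConv μ A B C = μ A * μ B := by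
  calc tripleConv μ A B C = ∫⁻ x, ∫⁻ y, A.indicator 1 x * B.indicator 1 y ∂μ ∂μ := by
        refine lintegral_congr fun x => lintegral_congr fun y => ?_
        by_cases hx : x ∈ A
        · by_cases hy : y ∈ B
          · simp [h x hx y hy]
          · simp [hy]
        · simp [hx]
    _ = μ A * μ B := by
        simp_rw [lintegral_const_mul _ (measurable_indicator_one' hB)]
        rw [lintegral_mul_const _ (measurable_indicator_one' hA)]
        simp [hA, hB]

theorem lintegral_lintegral_add_indicator {G : Type*} [AddCommGroup G] [MeasurableSpace G]
    [MeasurableAdd₂ G] [MeasurableNeg G] {μ : Measure G} [SFinite μ] [μ.IsAddLeftInvariant]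
    {A B C : Set G} {D : Set (G × G)} (hA : MeasurableSet A) (hB : MeasurableSet B)
    (hC : MeasurableSet C) (hD : MeasurableSet D) :
    ∫⁻ x, ∫⁻ y, (A.indicator 1 x * B.indicator 1 y
        + C.indicator 1 (x + y) * D.indicator 1 (x, y) : ℝ≥0∞) ∂μ ∂μ
      = μ A * μ B + ∫⁻ z, C.indicator 1 z * μ {x | (x, z - x) ∈ D} ∂μ := by
  have hD' := measurable_indicator_one' hD
  have hF : Measurable (Function.uncurry fun x y : G =>
      (C.indicator 1 (x + y) * D.indicator 1 (x, y) : ℝ≥0∞)) :=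
    ((measurable_indicator_one' hC).comp measurable_add).mul hD'
  have h1 : ∀ x, ∫⁻ y, (A.indicator 1 x * B.indicator 1 y
        + C.indicator 1 (x + y) * D.indicator 1 (x, y) : ℝ≥0∞) ∂μ
      = A.indicator 1 x * μ B + ∫⁻ y, C.indicator 1 (x + y) * D.indicator 1 (x, y) ∂μ := by
    intro x
    rw [lintegral_add_left ((measurable_indicator_one' hB).const_mul _),
      lintegral_const_mul _ (measurable_indicator_one' hB), lintegral_indicator_one hB]
  simp_rw [h1]
  rw [lintegral_add_left ((measurable_indicator_one' hA).mul_const _),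
    lintegral_mul_const _ (measurable_indicator_one' hA), lintegral_indicator_one hA,
    lintegral_lintegral_sub_swap hF]
  congr 1
  refine lintegral_congr fun z => ?_
  have hm : Measurable fun x : G => (x, z - x) :=
    measurable_id.prodMk (measurable_const.sub measurable_id)
  simp only [add_sub_cancel]
  refine (lintegral_const_mul _ (hD'.comp hm)).trans ?_
  congr 1
  exact lintegral_indicator_one (hm hD)

theorem tripleConv_real_le {A B C : Set ℝ} (hA : MeasurableSet A) (hB : MeasurableSet B)
    (hC : MeasurableSet C) (hAf : volume A < ∞) (hBf : volume B < ∞) {t : ℝ≥0∞} (ht : 0 < t)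
    (htA : t < volume A) (htB : t < volume B) :
    tripleConv volume A B C ≤ (volume A - t) * (volume B - t) + t * volume C := by
  obtain ⟨x₀, hx₀, hx₀'⟩ := exists_volume_inter_Iio_eq hAf ht htA
  obtain ⟨y₀, hy₀, hy₀'⟩ := exists_volume_inter_Iio_eq hBf (t := volume B - t)
    (tsub_pos_of_lt htB) (ENNReal.sub_lt_self hBf.ne (ht.trans htB).ne' ht.ne')
  rw [ENNReal.sub_sub_cancel hBf.ne htB.le] at hy₀'
  set D : Set (ℝ × ℝ) := {p | p.1 ∈ A ∧ p.2 ∈ B ∧ (p.1 < x₀ ∨ y₀ ≤ p.2)} with hD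
  have hDm : MeasurableSet D := by
    refine (measurable_fst hA).inter ((measurable_snd hB).inter (MeasurableSet.union ?_ ?_))
    · exact measurableSet_lt measurable_fst measurable_const
    · exact measurableSet_le measurable_const measurable_snd
  calc tripleConv volume A B C
      ≤ ∫⁻ x, ∫⁻ y, ((A ∩ Set.Ici x₀).indicator 1 x * (B ∩ Set.Iio y₀).indicator 1 y
        + C.indicator 1 (x + y) * D.indicator 1 (x, y) : ℝ≥0∞) := by
        refine lintegral_mono fun x => lintegral_mono fun y => ?_
        by_cases hx : x ∈ A
        · by_cases hy : y ∈ B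
          · by_cases h : x < x₀ ∨ y₀ ≤ y
            · simp [hx, hy, hD, h]
            · have h' := h
              push Not at h'
              simp [hx, hy, hD, h, h']
              exact Set.indicator_le_self' (by simp) _
          · simp [hy]
        · simp [hx]
    _ = (volume A - t) * (volume B - t)
          + ∫⁻ z, C.indicator 1 z * volume {x | (x, z - x) ∈ D} := by
        rw [lintegral_lintegral_add_indicator (hA.inter measurableSet_Ici)
          (hB.inter measurableSet_Iio) hC hDm, hx₀', hy₀]
    _ ≤ (volume A - t) * (volume B - t) + ∫⁻ z, C.indicator 1 z * t := by
        gcongr with z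
        rcases le_or_gt x₀ (z - y₀) with h | h
        · rw [← hy₀', ← (Measure.measurePreserving_sub_left volume z).measure_preimage
            (hB.inter measurableSet_Ici).nullMeasurableSet]
          refine measure_mono fun x hx => ?_
          obtain ⟨-, h2, h3⟩ := hx
          refine ⟨h2, ?_⟩
          simp only [Set.mem_Ici] at *
          rcases h3 with h3 | h3 <;> linarith
        · rw [← hx₀]
          refine measure_mono fun x hx => ?_
          obtain ⟨h1, -, h3⟩ := hx
          refine ⟨h1, ?_⟩
          simp only [Set.mem_Iio] at *
          rcases h3 with h3 | h3 <;> linarith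
    _ = _ := by
        rw [lintegral_mul_const _ (measurable_indicator_one' hC), lintegral_indicator_one hC,
          mul_comm t]

/-- The open interval centered at `0` of length `v`. -/
def centeredInterval (v : ℝ≥0∞) : Set ℝ := {s | ENNReal.ofReal (2 * |s|) < v}

theorem measurableSet_centeredInterval (v : ℝ≥0∞) : MeasurableSet (centeredInterval v) :=
  measurableSet_lt (by fun_prop) measurable_const

theorem centeredInterval_top : centeredInterval ∞ = Set.univ := by
  ext; simp [centeredInterval, ENNReal.mul_lt_top]

theorem centeredInterval_ofReal (a : ℝ) :
    centeredInterval (ENNReal.ofReal a) = Set.Ioo (-(a / 2)) (a / 2) := by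
  ext s
  rw [centeredInterval, Set.mem_ofPred_eq, ENNReal.ofReal_lt_ofReal_iff', Set.mem_Ioo, ← abs_lt]
  constructor
  · rintro ⟨h, -⟩; linarith
  · intro h; have := abs_nonneg s; constructor <;> linarith

theorem volume_centeredInterval (v : ℝ≥0∞) : volume (centeredInterval v) = v := by
  rcases eq_or_ne v ∞ with rfl | h
  · simp [centeredInterval_top]
  · rw [← ENNReal.ofReal_toReal h, centeredInterval_ofReal, Real.volume_Ioo]
    congr 1; ring

theorem neg_preimage_centeredInterval (v : ℝ≥0∞) :
    Neg.neg ⁻¹' centeredInterval v = centeredInterval v := by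
  ext; simp [centeredInterval]

theorem add_mem_centeredInterval {a b c : ℝ≥0∞} (h : a + b ≤ c) {x y : ℝ}
    (hx : x ∈ centeredInterval a) (hy : y ∈ centeredInterval b) :
    x + y ∈ centeredInterval c := by
  refine lt_of_lt_of_le (lt_of_le_of_lt ?_ (ENNReal.add_lt_add hx hy)) h
  rw [← ENNReal.ofReal_add (by positivity) (by positivity)]
  exact ENNReal.ofReal_le_ofReal (by linarith [abs_add_le x y])

theorem le_tripleConv_Ioo {a b c t : ℝ} (ht : 0 < t) (hta : t < a) (htb : t < b)
    (hc : c = a + b - 2 * t) :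
    ENNReal.ofReal (a - t) * ENNReal.ofReal (b - t) + ENNReal.ofReal t * ENNReal.ofReal c ≤
      tripleConv volume (Set.Ioo (-(a / 2)) (a / 2)) (Set.Ioo (-(b / 2)) (b / 2))
        (Set.Ioo (-(c / 2)) (c / 2)) := by
  set m : ℝ → ℝ := fun z => max (-(a / 2)) (z - b / 2) with hm
  set D : Set (ℝ × ℝ) := {p | m (p.1 + p.2) < p.1 ∧ p.1 < m (p.1 + p.2) + t} with hD
  have hmm : Measurable m := by fun_prop
  have hDm : MeasurableSet D :=
    (measurableSet_lt (hmm.comp measurable_add) measurable_fst).inter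
      (measurableSet_lt measurable_fst ((hmm.comp measurable_add).add_const t))
  calc ENNReal.ofReal (a - t) * ENNReal.ofReal (b - t) + ENNReal.ofReal t * ENNReal.ofReal c
      = volume (Set.Ico (-(a / 2) + t) (a / 2)) * volume (Set.Ioc (-(b / 2)) (b / 2 - t))
        + ∫⁻ z, (Set.Ioo (-(c / 2)) (c / 2)).indicator 1 z * volume {x | (x, z - x) ∈ D} := by
        have h1 : ∀ z, volume {x | (x, z - x) ∈ D} = ENNReal.ofReal t := by
          intro z
          have : {x | (x, z - x) ∈ D} = Set.Ioo (m z) (m z + t) := by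
            ext x; simp [hD]
          rw [this, Real.volume_Ioo]; simp
        simp_rw [h1]
        rw [lintegral_mul_const _ (measurable_indicator_one' measurableSet_Ioo),
          lintegral_indicator_one measurableSet_Ioo, Real.volume_Ico, Real.volume_Ioc,
          Real.volume_Ioo, mul_comm (ENNReal.ofReal t)]
        congr 3 <;> ring
    _ = ∫⁻ x, ∫⁻ y, ((Set.Ico (-(a / 2) + t) (a / 2)).indicator 1 x
          * (Set.Ioc (-(b / 2)) (b / 2 - t)).indicator 1 y
        + (Set.Ioo (-(c / 2)) (c / 2)).indicator 1 (x + y) * D.indicator 1 (x, y) : ℝ≥0∞) := by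
        rw [lintegral_lintegral_add_indicator measurableSet_Ico measurableSet_Ioc
          measurableSet_Ioo hDm]
    _ ≤ _ := by
        refine lintegral_mono fun x => lintegral_mono fun y => ?_
        have e1 : -(a / 2) ≤ m (x + y) := le_max_left _ _
        have e2 : x + y - b / 2 ≤ m (x + y) := le_max_right _ _
        have e3 : m (x + y) = -(a / 2) ∨ m (x + y) = x + y - b / 2 := max_choice _ _
        by_cases h1 : x ∈ Set.Ico (-(a / 2) + t) (a / 2) ∧ y ∈ Set.Ioc (-(b / 2)) (b / 2 - t)
        · obtain ⟨hx, hy⟩ := h1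
          have h2 : (x, y) ∉ D := by
            rintro ⟨-, h3⟩
            simp only at h3
            rcases e3 with e3 | e3 <;> linarith [hx.1, hy.2]
          have h3 : x ∈ Set.Ioo (-(a / 2)) (a / 2) := ⟨by linarith [hx.1], hx.2⟩
          have h4 : y ∈ Set.Ioo (-(b / 2)) (b / 2) := ⟨hy.1, by linarith [hy.2]⟩
          have h5 : x + y ∈ Set.Ioo (-(c / 2)) (c / 2) :=
            ⟨by linarith [hx.1, hy.1], by linarith [hx.2, hy.2]⟩
          simp only [Set.indicator_of_mem, Set.indicator_of_notMem, hx, hy, h2, h3, h4, h5,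
            not_false_eq_true]
          simp
        · have h0 : (Set.Ico (-(a / 2) + t) (a / 2)).indicator 1 x
              * (Set.Ioc (-(b / 2)) (b / 2 - t)).indicator 1 y = (0 : ℝ≥0∞) := by
            rw [not_and_or] at h1
            rcases h1 with h1 | h1 <;> simp only [Set.indicator_of_notMem h1, zero_mul, mul_zero]
          rw [h0, zero_add]
          by_cases h2 : x + y ∈ Set.Ioo (-(c / 2)) (c / 2) ∧ (x, y) ∈ D
          · obtain ⟨h2, h3⟩ := h2
            have h4 : m (x + y) < x := h3.1
            have h5 : x < m (x + y) + t := h3.2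
            have h6 : x ∈ Set.Ioo (-(a / 2)) (a / 2) := by
              constructor
              · linarith
              · rcases e3 with e3 | e3 <;> linarith [h2.2]
            have h7 : y ∈ Set.Ioo (-(b / 2)) (b / 2) := by
              constructor
              · rcases e3 with e3 | e3 <;> linarith [h2.1]
              · linarith
            simp only [Set.indicator_of_mem, h2, h3, h6, h7]
            simp
          · rw [not_and_or] at h2
            rcases h2 with h2 | h2 <;> simp [Set.indicator_of_notMem h2]

theorem tripleConv_le_centeredInterval {A B C : Set ℝ} (hA : MeasurableSet A)
    (hB : MeasurableSet B) (hC : MeasurableSet C) :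
    tripleConv volume A B C ≤ tripleConv volume (centeredInterval (volume A))
      (centeredInterval (volume B)) (centeredInterval (volume C)) := by
  have hm := measurableSet_centeredInterval
  rcases le_or_gt (volume A + volume B) (volume C) with h1 | h1
  · rw [tripleConv_eq_mul (hm _) (hm _) fun x hx y hy => add_mem_centeredInterval h1 hx hy,
      volume_centeredInterval, volume_centeredInterval]
    exact tripleConv_le_mul_left A B C hA hB
  rcases le_or_gt (volume B + volume C) (volume A) with h2 | h2
  · rw [tripleConv_comm hA hB hC, tripleConv_comm (hm _) (hm _) (hm _), tripleConv_swap B,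
      tripleConv_swap (centeredInterval (volume B)), neg_preimage_centeredInterval,
      tripleConv_eq_mul (hm _) (hm _) fun x hx y hy => add_mem_centeredInterval h2 hx hy,
      volume_centeredInterval, volume_centeredInterval]
    refine (tripleConv_le_mul_left _ _ _ (measurable_neg hB) hC).trans_eq ?_
    rw [(Measure.measurePreserving_neg volume).measure_preimage hB.nullMeasurableSet]
  rcases le_or_gt (volume A + volume C) (volume B) with h3 | h3
  · rw [tripleConv_swap A, tripleConv_swap (centeredInterval (volume A)), neg_preimage_centeredInterval,
      tripleConv_eq_mul (hm _) (hm _) fun x hx y hy => add_mem_centeredInterval h3 hx hy,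
      volume_centeredInterval, volume_centeredInterval]
    refine (tripleConv_le_mul_left _ _ _ (measurable_neg hA) hC).trans_eq ?_
    rw [(Measure.measurePreserving_neg volume).measure_preimage hA.nullMeasurableSet]
  have hAf : volume A ≠ ∞ := fun h => by simp [h] at h2
  have hBf : volume B ≠ ∞ := fun h => by simp [h] at h3
  have hCf : volume C ≠ ∞ := fun h => by simp [h] at h1
  obtain ⟨a, ha0, ha⟩ : ∃ a : ℝ, 0 ≤ a ∧ volume A = ENNReal.ofReal a :=
    ⟨_, ENNReal.toReal_nonneg, (ENNReal.ofReal_toReal hAf).symm⟩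
  obtain ⟨b, hb0, hb⟩ : ∃ a : ℝ, 0 ≤ a ∧ volume B = ENNReal.ofReal a :=
    ⟨_, ENNReal.toReal_nonneg, (ENNReal.ofReal_toReal hBf).symm⟩
  obtain ⟨c, hc0, hc⟩ : ∃ a : ℝ, 0 ≤ a ∧ volume C = ENNReal.ofReal a :=
    ⟨_, ENNReal.toReal_nonneg, (ENNReal.ofReal_toReal hCf).symm⟩
  rw [ha, hb, hc, ← ENNReal.ofReal_add (by assumption) (by assumption),
    ENNReal.ofReal_lt_ofReal_iff'] at h1 h2 h3
  set t := (a + b - c) / 2 with ht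
  have ht0 : 0 < t := by linarith [h1.1]
  have hta : t < a := by linarith [h3.1]
  have htb : t < b := by linarith [h2.1]
  have key := tripleConv_real_le hA hB hC hAf.lt_top hBf.lt_top (ENNReal.ofReal_pos.2 ht0)
    (by rw [ha]; exact (ENNReal.ofReal_lt_ofReal_iff (by linarith)).2 hta)
    (by rw [hb]; exact (ENNReal.ofReal_lt_ofReal_iff (by linarith)).2 htb)
  rw [ha, hb, hc, centeredInterval_ofReal, centeredInterval_ofReal, centeredInterval_ofReal]
  rw [ha, hb, hc, ← ENNReal.ofReal_sub _ ht0.le, ← ENNReal.ofReal_sub _ ht0.le] at key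
  exact key.trans (le_tripleConv_Ioo ht0 hta htb (by linarith))

section Steiner

variable {W : Type*}

/-- The slice of `A ⊆ ℝ × W` over `w`. -/
def fiber (A : Set (ℝ × W)) (w : W) : Set ℝ := {s | (s, w) ∈ A}

/-- Steiner symmetrization of a subset of `ℝ × W` along the first factor. -/
def steiner (A : Set (ℝ × W)) : Set (ℝ × W) :=
  {p | p.1 ∈ centeredInterval (volume (fiber A p.2))}

theorem fiber_steiner (A : Set (ℝ × W)) (w : W) :
    fiber (steiner A) w = centeredInterval (volume (fiber A w)) := rfl

theorem centeredInterval_mono {a b : ℝ≥0∞} (h : a ≤ b) :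
    centeredInterval a ⊆ centeredInterval b := fun _ hs => lt_of_lt_of_le hs h

theorem steiner_mono {A B : Set (ℝ × W)} (h : A ⊆ B) : steiner A ⊆ steiner B :=
  fun p hp => by
    have hsub : fiber A p.2 ⊆ fiber B p.2 := fun _ hs => h hs
    exact centeredInterval_mono (measure_mono hsub) hp

theorem steiner_eq_self {Q : Set (ℝ × W)} {q : W → ℝ≥0∞}
    (hQ : ∀ w, fiber Q w = centeredInterval (q w)) : steiner Q = Q := by
  ext ⟨s, w⟩
  change s ∈ centeredInterval (volume (fiber Q w)) ↔ s ∈ fiber Q w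
  rw [hQ, volume_centeredInterval]

variable [MeasurableSpace W]

theorem measurableSet_fiber {A : Set (ℝ × W)} (hA : MeasurableSet A) (w : W) :
    MeasurableSet (fiber A w) := measurable_prodMk_right hA

theorem measurableSet_steiner {A : Set (ℝ × W)} (hA : MeasurableSet A) :
    MeasurableSet (steiner A) :=
  measurableSet_lt (by fun_prop) ((measurable_measure_prodMk_right hA).comp measurable_snd)

variable {ν : Measure W} [SFinite ν]

theorem measure_eq_lintegral_fiber {A : Set (ℝ × W)} (hA : MeasurableSet A) :
    ((volume : Measure ℝ).prod ν) A = ∫⁻ w, volume (fiber A w) ∂ν :=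
  Measure.prod_apply_symm hA

theorem measure_steiner {A : Set (ℝ × W)} (hA : MeasurableSet A) :
    ((volume : Measure ℝ).prod ν) (steiner A) = ((volume : Measure ℝ).prod ν) A := by
  rw [measure_eq_lintegral_fiber (measurableSet_steiner hA), measure_eq_lintegral_fiber hA]
  simp_rw [fiber_steiner, volume_centeredInterval]

theorem measure_steiner_diff_add_le {A Q G : Set (ℝ × W)} (hA : MeasurableSet A)
    (hQ : MeasurableSet Q) (hG : MeasurableSet G) {q : W → ℝ≥0∞} (hq : ∀ w, q w ≠ ∞)
    (hQq : ∀ w, fiber Q w = centeredInterval (q w))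
    (h1 : ∀ w, volume (fiber G w) ≤ volume (fiber (A \ Q) w))
    (h2 : ∀ w, volume (fiber G w) ≤ volume (fiber (Q \ A) w)) :
    ((volume : Measure ℝ).prod ν) (steiner A \ Q) + ((volume : Measure ℝ).prod ν) G ≤
      ((volume : Measure ℝ).prod ν) (A \ Q) := by
  have hGm : Measurable fun w => volume (fiber G w) := measurable_measure_prodMk_right hG
  rw [measure_eq_lintegral_fiber ((measurableSet_steiner hA).diff hQ),
    measure_eq_lintegral_fiber hG, measure_eq_lintegral_fiber (hA.diff hQ),
    ← lintegral_add_right _ hGm]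
  refine lintegral_mono fun w => ?_
  have e1 : volume (fiber A w)
      = volume (fiber A w ∩ fiber Q w) + volume (fiber (A \ Q) w) :=
    (measure_inter_add_sdiff _ (measurableSet_fiber hQ w)).symm
  have e2 : q w = volume (fiber A w ∩ fiber Q w) + volume (fiber (Q \ A) w) := by
    rw [← volume_centeredInterval (q w), ← hQq w, Set.inter_comm]
    exact (measure_inter_add_sdiff _ (measurableSet_fiber hA w)).symm
  have e3 : volume (fiber (steiner A \ Q) w) = volume (fiber A w) - q w := by
    change volume (fiber (steiner A) w \ fiber Q w) = _
    rw [fiber_steiner, hQq]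
    rcases le_total (volume (fiber A w)) (q w) with h | h
    · rw [Set.sdiff_eq_empty.2 (centeredInterval_mono h), measure_empty, tsub_eq_zero_of_le h]
    · rw [measure_sdiff (centeredInterval_mono h)
        (measurableSet_centeredInterval _).nullMeasurableSet
        (by rw [volume_centeredInterval]; exact hq w),
        volume_centeredInterval, volume_centeredInterval]
  have hfin : volume (fiber A w ∩ fiber Q w) ≠ ∞ := fun h => hq w (by rw [e2, h, top_add])
  simp only
  rw [e3, e1, e2, ENNReal.add_sub_add_eq_sub_left hfin]
  refine (add_le_add_right (le_min (h1 w) (h2 w)) _).trans ?_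
  rcases le_total (volume (fiber (A \ Q) w)) (volume (fiber (Q \ A) w)) with h | h
  · rw [tsub_eq_zero_of_le h, min_eq_left h, zero_add]
  · rw [min_eq_right h, tsub_add_cancel_of_le h]

variable [AddCommGroup W] [MeasurableAdd₂ W]

instance measurableAdd₂_real_prod : MeasurableAdd₂ (ℝ × W) :=
  ⟨((measurable_fst.comp measurable_fst).add (measurable_fst.comp measurable_snd)).prodMk
    ((measurable_snd.comp measurable_fst).add (measurable_snd.comp measurable_snd))⟩

theorem tripleConv_prod_eq {A B C : Set (ℝ × W)} (hA : MeasurableSet A) (hB : MeasurableSet B)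
    (hC : MeasurableSet C) :
    tripleConv ((volume : Measure ℝ).prod ν) A B C = ∫⁻ w, ∫⁻ w', tripleConv volume (fiber A w)
      (fiber B w') (fiber C (w + w')) ∂ν ∂ν := by
  have hm := measurable_tripleConv_integrand hA hB hC
  rw [tripleConv, lintegral_prod_symm' _ hm.lintegral_prod_right]
  refine lintegral_congr fun w => ?_
  have hm1 : Measurable fun q : (ℝ × W) × ℝ => (A.indicator 1 (q.1.1, w)
      * B.indicator 1 (q.2, q.1.2) * C.indicator 1 ((q.1.1, w) + (q.2, q.1.2)) : ℝ≥0∞) :=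
    hm.comp (by fun_prop : Measurable fun q : (ℝ × W) × ℝ => ((q.1.1, w), (q.2, q.1.2)))
  calc _ = ∫⁻ s : ℝ, ∫⁻ w', (∫⁻ s' : ℝ, (A.indicator 1 (s, w) * B.indicator 1 (s', w')
          * C.indicator 1 ((s, w) + (s', w')) : ℝ≥0∞)) ∂ν := by
        refine lintegral_congr fun s => ?_
        exact lintegral_prod_symm' _ (hm.comp measurable_prodMk_left)
    _ = _ := by
        rw [lintegral_lintegral_swap (Measurable.aemeasurable hm1.lintegral_prod_right')]
        rfl

theorem tripleConv_le_steiner {A B C : Set (ℝ × W)} (hA : MeasurableSet A)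
    (hB : MeasurableSet B) (hC : MeasurableSet C) :
    tripleConv ((volume : Measure ℝ).prod ν) A B C ≤
      tripleConv ((volume : Measure ℝ).prod ν) (steiner A) (steiner B) (steiner C) := by
  rw [tripleConv_prod_eq hA hB hC, tripleConv_prod_eq (measurableSet_steiner hA)
    (measurableSet_steiner hB) (measurableSet_steiner hC)]
  refine lintegral_mono fun w => lintegral_mono fun w' => ?_
  exact tripleConv_le_centeredInterval (measurableSet_fiber hA w) (measurableSet_fiber hB w')
    (measurableSet_fiber hC _)

end Steiner

section InnerProduct

variable {E : Type*} [NormedAddCommGroup E] [InnerProductSpace ℝ E] [FiniteDimensional ℝ E]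
  [MeasurableSpace E] [BorelSpace E]

theorem exists_slicing {u : E} (hu : ‖u‖ = 1) :
    ∃ e : E ≃ᵐ ℝ × (ℝ ∙ u)ᗮ, MeasurePreserving e volume (volume.prod volume) ∧
      (∀ x y, e (x + y) = e x + e y) ∧ (∀ x, ‖x‖ ^ 2 = (e x).1 ^ 2 + ‖(e x).2‖ ^ 2) ∧
      ∀ c : ℝ, (e (c • u)).2 = 0 := by
  set l : E ≃ₗᵢ[ℝ] WithLp 2 (ℝ × (ℝ ∙ u)ᗮ) := (ℝ ∙ u).orthogonalDecomposition.trans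
    (LinearIsometryEquiv.withLpProdCongr 2 (LinearIsometryEquiv.toSpanUnitSingleton u hu).symm
      (LinearIsometryEquiv.refl ℝ _)) with hl
  refine ⟨l.toHomeomorph.toMeasurableEquiv.trans (MeasurableEquiv.toLp 2 _).symm,
    l.measurePreserving.trans (WithLp.volume_preserving_ofLp _ _), fun x y => ?_, fun x => ?_,
    fun c => ?_⟩
  · change WithLp.ofLp (l (x + y)) = WithLp.ofLp (l x) + WithLp.ofLp (l y)
    rw [map_add, WithLp.ofLp_add]
  · change ‖x‖ ^ 2 = (l x).fst ^ 2 + ‖(l x).snd‖ ^ 2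
    rw [← l.norm_map x, WithLp.prod_norm_sq_eq_of_L2, Real.norm_eq_abs, sq_abs]
  · change ((ℝ ∙ u).orthogonalDecomposition (c • u)).snd = 0
    rw [Submodule.snd_orthogonalDecomposition_apply]
    simp [Submodule.mem_span_singleton_self]

theorem tripleConv_preimage {X Y : Type*} [AddCommMonoid X] [MeasurableSpace X] [AddCommMonoid Y]
    [MeasurableSpace Y] {μ : Measure X} {ν : Measure Y} (e : X ≃ᵐ Y) (he : MeasurePreserving e μ ν)
    (hadd : ∀ x y, e (x + y) = e x + e y) (A B C : Set Y) :
    tripleConv μ (e ⁻¹' A) (e ⁻¹' B) (e ⁻¹' C) = tripleConv ν A B C := by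
  rw [tripleConv, tripleConv, ← he.lintegral_comp_emb e.measurableEmbedding]
  refine lintegral_congr fun x => ?_
  rw [← he.lintegral_comp_emb e.measurableEmbedding]
  refine lintegral_congr fun y => ?_
  rw [← hadd]
  rfl

omit [FiniteDimensional ℝ E] [BorelSpace E] in
theorem fiber_ball_eq_centeredInterval {u : E} {e : E ≃ᵐ ℝ × (ℝ ∙ u)ᗮ}
    (hn : ∀ x, ‖x‖ ^ 2 = (e x).1 ^ 2 + ‖(e x).2‖ ^ 2) {r : ℝ} (hr : 0 < r) (w : (ℝ ∙ u)ᗮ) :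
    fiber (e.symm ⁻¹' Metric.ball 0 r) w
      = centeredInterval (ENNReal.ofReal (2 * √(r ^ 2 - ‖w‖ ^ 2))) := by
  ext s
  have h : ‖e.symm (s, w)‖ ^ 2 = s ^ 2 + ‖w‖ ^ 2 := by simpa using hn (e.symm (s, w))
  rw [centeredInterval_ofReal, mul_div_cancel_left₀ _ two_ne_zero, Set.mem_Ioo, ← abs_lt,
    Real.lt_sqrt (abs_nonneg s), sq_abs]
  change e.symm (s, w) ∈ Metric.ball 0 r ↔ _
  rw [mem_ball_zero_iff, ← sq_lt_sq₀ (norm_nonneg _) hr.le, h, lt_sub_iff_add_lt]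

/-- Steiner symmetrization along the direction `z`. The last two clauses say that it does not
increase the part outside a centered ball, with a quantified gain, and that it preserves
inclusion in a centered ball. -/
theorem exists_steiner (z : E) :
    ∃ S : Set E → Set E, (∀ A, MeasurableSet A → MeasurableSet (S A)) ∧
      (∀ A, MeasurableSet A → volume (S A) = volume A) ∧
      (∀ A B C, MeasurableSet A → MeasurableSet B → MeasurableSet C →
        tripleConv volume A B C ≤ tripleConv volume (S A) (S B) (S C)) ∧
      (∀ r, 0 < r → ∀ A, MeasurableSet A → volume (S A \ Metric.ball 0 r) +
        volume ((A \ Metric.ball 0 r) ∩ (· + z) ⁻¹' (Metric.ball 0 r \ A)) ≤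
          volume (A \ Metric.ball 0 r)) ∧
      ∀ r, 0 < r → ∀ A, A ⊆ Metric.ball 0 r → S A ⊆ Metric.ball 0 r := by
  rcases eq_or_ne z 0 with rfl | hz
  · refine ⟨id, fun _ h => h, fun _ _ => rfl, fun _ _ _ _ _ _ => le_rfl, fun r hr A hA => ?_,
      fun _ _ _ h => h⟩
    have : (A \ Metric.ball 0 r) ∩ (· + (0 : E)) ⁻¹' (Metric.ball 0 r \ A) = ∅ := by
      ext x; simp +contextual
    rw [this, measure_empty, add_zero, id]
  have hu : ‖(‖z‖⁻¹ • z)‖ = 1 := norm_smul_inv_norm (𝕜 := ℝ) hz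
  have hzu : z = ‖z‖ • (‖z‖⁻¹ • z) := by rw [smul_inv_smul₀ (norm_ne_zero_iff.2 hz)]
  set u : E := ‖z‖⁻¹ • z
  obtain ⟨e, he, hadd, hn, hz0⟩ := exists_slicing hu
  have hpre : ∀ A : Set E, e ⁻¹' (e.symm ⁻¹' A) = A := fun A => by
    rw [← Set.preimage_comp, e.symm_comp_self, Set.preimage_id]
  have hsm : ∀ A : Set E, MeasurableSet A → MeasurableSet (e.symm ⁻¹' A) :=
    fun A hA => e.symm.measurable hA
  have hvol : ∀ A : Set E, (volume.prod volume) (e.symm ⁻¹' A) = volume A := fun A => by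
    rw [← he.measure_preimage_equiv, hpre]
  have hball : ∀ r : ℝ, 0 < r →
      steiner (e.symm ⁻¹' Metric.ball (0 : E) r) = e.symm ⁻¹' Metric.ball 0 r :=
    fun r hr => steiner_eq_self fun w => fiber_ball_eq_centeredInterval hn hr w
  refine ⟨fun A => e ⁻¹' steiner (e.symm ⁻¹' A), fun A hA =>
    e.measurable (measurableSet_steiner (hsm A hA)), fun A hA => ?_, fun A B C hA hB hC => ?_,
    fun r hr A hA => ?_, fun r hr A hA => ?_⟩
  · rw [he.measure_preimage_equiv, measure_steiner (hsm A hA), hvol]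
  · rw [tripleConv_preimage e he hadd]
    nth_rw 1 [← hpre A, ← hpre B, ← hpre C]
    rw [tripleConv_preimage e he hadd]
    exact tripleConv_le_steiner (hsm A hA) (hsm B hB) (hsm C hC)
  · set Q : Set E := Metric.ball 0 r with hQ
    have hQm : MeasurableSet Q := Metric.isOpen_ball.measurableSet
    set G : Set E := (A \ Q) ∩ (· + z) ⁻¹' (Q \ A) with hG
    have hGm : MeasurableSet G :=
      (hA.diff hQm).inter ((measurable_add_const z) (hQm.diff hA))
    have key := measure_steiner_diff_add_le (ν := (volume : Measure (ℝ ∙ u)ᗮ)) (hsm A hA)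
      (hsm Q hQm) (hsm G hGm) (fun _ => ENNReal.ofReal_ne_top)
      (fun w => fiber_ball_eq_centeredInterval hn hr w)
      (fun w => measure_mono fun s hs => hs.1) (fun w => ?_)
    · rw [hvol, ← Set.preimage_sdiff, hvol] at key
      rwa [← hpre Q, ← Set.preimage_sdiff, he.measure_preimage_equiv, hpre]
    · rw [← measure_preimage_add_right volume (e z).1 (fiber (_ \ _) w)]
      refine measure_mono fun s hs => ?_
      have h2 : e.symm (s, w) + z ∈ Q \ A := hs.2
      have h3 : e.symm (s + (e z).1, w) = e.symm (s, w) + z := by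
        rw [e.symm_apply_eq, hadd, e.apply_symm_apply]
        have : (e z).2 = 0 := by rw [hzu]; exact hz0 _
        ext <;> simp [this]
      rw [← h3] at h2
      exact h2
  · have h := steiner_mono (Set.preimage_mono (f := e.symm) hA)
    rw [hball r hr] at h
    have := Set.preimage_mono (f := e) h
    rwa [hpre] at this

end InnerProduct

section Sub

variable {G : Type*} [AddCommGroup G] [MeasurableSpace G] [MeasurableAdd₂ G] [MeasurableNeg G]
  {μ : Measure G} [SFinite μ] [μ.IsAddLeftInvariant] [μ.IsNegInvariant]

omit [MeasurableNeg G] [SFinite μ] [μ.IsAddLeftInvariant] [μ.IsNegInvariant] in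
theorem tripleConv_le_add_diff_left [SFinite μ] {A B C Q : Set G} (hA : MeasurableSet A)
    (hB : MeasurableSet B) (hC : MeasurableSet C) (hQ : MeasurableSet Q) :
    tripleConv μ A B C ≤ tripleConv μ Q B C + μ (A \ Q) * μ B := by
  refine le_trans ?_ (add_le_add_right (tripleConv_le_mul_left (A \ Q) B C (hA.diff hQ) hB) _)
  have hm := measurable_tripleConv_integrand hQ hB hC
  have h1 : ∀ x, Measurable fun y : G =>
      (Q.indicator 1 x * B.indicator 1 y * C.indicator 1 (x + y) : ℝ≥0∞) := fun x =>
    hm.comp measurable_prodMk_left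
  rw [tripleConv, tripleConv, tripleConv, ← lintegral_add_left hm.lintegral_prod_right]
  refine lintegral_mono fun x => ?_
  change _ ≤ (∫⁻ y, _ ∂μ) + _
  rw [← lintegral_add_left (h1 x)]
  refine lintegral_mono fun y => ?_
  simp only [← add_mul]
  gcongr
  by_cases hx : x ∈ A <;> by_cases hxQ : x ∈ Q <;> simp [hx, hxQ]

theorem tripleConv_le_add_diff_right {A B C Q : Set G} (hA : MeasurableSet A)
    (hB : MeasurableSet B) (hC : MeasurableSet C) (hQ : MeasurableSet Q) :
    tripleConv μ A B C ≤ tripleConv μ A B Q + μ (C \ Q) * μ A := by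
  have hA' : MeasurableSet (Neg.neg ⁻¹' A) := measurable_neg hA
  rw [tripleConv_swap A B C, tripleConv_swap A B Q, tripleConv_comm hA' hC hB,
    tripleConv_comm hA' hQ hB, ← Measure.measure_preimage_neg μ A]
  exact tripleConv_le_add_diff_left hC hA' hB hQ

theorem tripleConv_le_add_diff {A B C A' B' C' : Set G} (hA : MeasurableSet A)
    (hB : MeasurableSet B) (hC : MeasurableSet C) (hA' : MeasurableSet A')
    (hB' : MeasurableSet B') (hC' : MeasurableSet C') {v : ℝ≥0∞} (hv : μ B ≤ v) (hv' : μ A' ≤ v) :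
    tripleConv μ A B C ≤ tripleConv μ A' B' C'
      + (μ (A \ A') + μ (B \ B') + μ (C \ C')) * v := by
  calc tripleConv μ A B C ≤ tripleConv μ A' B C + μ (A \ A') * v :=
        (tripleConv_le_add_diff_left hA hB hC hA').trans (by gcongr)
    _ ≤ tripleConv μ A' B' C + μ (B \ B') * v + μ (A \ A') * v := by
        gcongr
        rw [tripleConv_comm hA' hB hC, tripleConv_comm hA' hB' hC]
        exact (tripleConv_le_add_diff_left hB hA' hC hB').trans (by gcongr)
    _ ≤ tripleConv μ A' B' C' + μ (C \ C') * v + μ (B \ B') * v + μ (A \ A') * v := by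
        gcongr
        exact (tripleConv_le_add_diff_right hA' hB' hC hC').trans (by gcongr)
    _ = _ := by ring

end Sub

section InnerProduct

variable {E : Type*} [NormedAddCommGroup E] [InnerProductSpace ℝ E] [FiniteDimensional ℝ E]
  [MeasurableSpace E] [BorelSpace E]

theorem lintegral_measure_inter_preimage_add {S T : Set E} (hS : MeasurableSet S)
    (hT : MeasurableSet T) :
    ∫⁻ z, volume (S ∩ (· + z) ⁻¹' T) = volume S * volume T := by
  have h1 : ∀ z, volume (S ∩ (· + z) ⁻¹' T)
      = ∫⁻ x, (S.indicator 1 x * T.indicator 1 (x + z) : ℝ≥0∞) := fun z => by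
    rw [← lintegral_indicator_one (hS.inter (measurable_add_const z hT))]
    refine lintegral_congr fun x => ?_
    rw [Set.inter_indicator_one]
    rfl
  have hm : Measurable (Function.uncurry fun z x : E =>
      (S.indicator 1 x * T.indicator 1 (x + z) : ℝ≥0∞)) :=
    ((measurable_indicator_one' hS).comp measurable_snd).mul
      ((measurable_indicator_one' hT).comp (measurable_snd.add measurable_fst))
  simp_rw [h1]
  rw [lintegral_lintegral_swap hm.aemeasurable]
  have h2 : ∀ x : E, ∫⁻ z, (S.indicator 1 x * T.indicator 1 (x + z) : ℝ≥0∞)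
      = S.indicator 1 x * volume T := fun x => by
    have hTx : Measurable fun z => T.indicator (1 : E → ℝ≥0∞) (x + z) :=
      (measurable_indicator_one' hT).comp (measurable_const_add x)
    rw [lintegral_const_mul _ hTx, lintegral_add_left_eq_self, lintegral_indicator_one hT]
  simp_rw [h2]
  rw [lintegral_mul_const _ (measurable_indicator_one' hS), lintegral_indicator_one hS]

theorem exists_le_measure_inter_preimage_add {S T : Set E} (hS : MeasurableSet S)
    (hT : MeasurableSet T) {R : ℝ} (hSR : S ⊆ Metric.ball 0 R) (hTR : T ⊆ Metric.ball 0 R) :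
    ∃ z, volume S * volume T ≤
      volume (S ∩ (· + z) ⁻¹' T) * (2 * volume (Metric.ball (0 : E) (2 * R))) := by
  by_contra! h
  set V := volume (Metric.ball (0 : E) (2 * R)) with hV
  have hVf : V ≠ ∞ := measure_ball_lt_top.ne
  have hp : volume S * volume T ≠ 0 := fun h0 => by simpa [h0] using h 0
  have hpf : volume S * volume T ≠ ∞ :=
    ENNReal.mul_ne_top (measure_mono hSR |>.trans_lt measure_ball_lt_top).ne
      (measure_mono hTR |>.trans_lt measure_ball_lt_top).ne
  have key : volume S * volume T * (2 * V) ≤ volume S * volume T * V := by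
    calc volume S * volume T * (2 * V)
        = ∫⁻ z, volume (S ∩ (· + z) ⁻¹' T) * (2 * V) := by
          rw [lintegral_mul_const' _ _ (ENNReal.mul_ne_top (by simp) hVf),
            lintegral_measure_inter_preimage_add hS hT]
      _ ≤ ∫⁻ z, (Metric.ball (0 : E) (2 * R)).indicator (fun _ => volume S * volume T) z := by
          refine lintegral_mono fun z => ?_
          by_cases hz : z ∈ Metric.ball (0 : E) (2 * R)
          · rw [Set.indicator_of_mem hz]
            exact (h z).le
          · have : S ∩ (· + z) ⁻¹' T = ∅ := by
              ext x
              simp only [Set.mem_inter_iff, Set.mem_preimage, Set.mem_empty_iff_false, iff_false,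
                not_and]
              intro hx hxz
              apply hz
              have h1 := hSR hx
              have h2 := hTR hxz
              rw [mem_ball_zero_iff] at *
              have h3 : ‖z‖ ≤ ‖x + z‖ + ‖x‖ := by simpa using norm_sub_le (x + z) x
              linarith
            simp [this]
      _ = _ := by
          rw [lintegral_indicator Metric.isOpen_ball.measurableSet, setLIntegral_const]
  have hV0 : V ≠ 0 := by
    intro h0
    have hR : ¬ 0 < R := fun hR =>
      (Metric.measure_ball_pos volume (0 : E) (by positivity : 0 < 2 * R)).ne' h0
    have : S = ∅ := by
      rw [Metric.ball_eq_empty.2 (not_lt.1 hR)] at hSR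
      exact Set.subset_empty_iff.1 hSR
    simp [this] at hp
  rw [ENNReal.mul_le_mul_iff_right hp hpf] at key
  have : V + V ≤ V + 0 := by simpa [two_mul] using key
  rw [ENNReal.add_le_add_iff_left hVf] at this
  exact hV0 (nonpos_iff_eq_zero.1 this)

theorem volume_diff_comm {A Q : Set E} (hA : MeasurableSet A) (hQ : MeasurableSet Q)
    (h : volume A = volume Q) (hf : volume A ≠ ∞) : volume (Q \ A) = volume (A \ Q) := by
  have h1 := measure_inter_add_sdiff (μ := volume) A hQ
  have h2 := measure_inter_add_sdiff (μ := volume) Q hA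
  rw [← h, Set.inter_comm, ← h1, ENNReal.add_right_inj] at h2
  · exact h2
  · exact (measure_mono Set.inter_subset_left |>.trans_lt hf.lt_top).ne

/-- A symmetrization step which reduces the excess over a centered ball of the same volume. -/
theorem exists_steiner_gain {A : Set E} (hA : MeasurableSet A) {r R : ℝ} (hR : 0 < R)
    (hAR : A ⊆ Metric.ball 0 R) (hrR : r ≤ R)
    (hAr : volume A = volume (Metric.ball (0 : E) r)) :
    ∃ S : Set E → Set E, (∀ A, MeasurableSet A → MeasurableSet (S A)) ∧
      (∀ A, MeasurableSet A → volume (S A) = volume A) ∧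
      (∀ A B C, MeasurableSet A → MeasurableSet B → MeasurableSet C →
        tripleConv volume A B C ≤ tripleConv volume (S A) (S B) (S C)) ∧
      (∀ r, ∀ A, MeasurableSet A →
        volume (S A \ Metric.ball 0 r) ≤ volume (A \ Metric.ball 0 r)) ∧
      (∀ A, A ⊆ Metric.ball 0 R → S A ⊆ Metric.ball 0 R) ∧
      volume (S A \ Metric.ball 0 r) + volume (A \ Metric.ball 0 r) ^ 2 /
        (2 * volume (Metric.ball (0 : E) (2 * R))) ≤ volume (A \ Metric.ball 0 r) := by
  have hQ : MeasurableSet (Metric.ball (0 : E) r) := Metric.isOpen_ball.measurableSet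
  have hAf : volume A ≠ ∞ := (measure_mono hAR |>.trans_lt measure_ball_lt_top).ne
  obtain ⟨z, hz⟩ := exists_le_measure_inter_preimage_add (hA.diff hQ) (hQ.diff hA)
    (Set.sdiff_subset.trans hAR) (Set.sdiff_subset.trans (Metric.ball_subset_ball hrR))
  obtain ⟨S, h1, h2, h3, h4, h5⟩ := exists_steiner z
  refine ⟨S, h1, h2, h3, fun r A hA => ?_, h5 R hR, ?_⟩
  · rcases le_or_gt r 0 with hr | hr
    · rw [Metric.ball_eq_empty.2 hr, Set.sdiff_empty, Set.sdiff_empty, h2 A hA]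
    · exact le_self_add.trans (h4 r hr A hA)
  · rcases le_or_gt r 0 with hr | hr
    · rw [Metric.ball_eq_empty.2 hr, measure_empty] at hAr
      simp [Metric.ball_eq_empty.2 hr, h2 A hA, hAr]
    · refine le_trans ?_ (h4 r hr A hA)
      gcongr
      rw [sq]
      rw [volume_diff_comm hA hQ hAr hAf] at hz
      exact ENNReal.div_le_of_le_mul hz

variable [Nontrivial E]

theorem exists_volume_ball_eq {v : ℝ≥0∞} (hv : v ≠ ∞) :
    ∃ r, 0 ≤ r ∧ volume (Metric.ball (0 : E) r) = v := by
  have h0 : volume (Metric.ball (0 : E) 1) ≠ 0 :=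
    (Metric.measure_ball_pos volume (0 : E) one_pos).ne'
  have hf : volume (Metric.ball (0 : E) 1) ≠ ∞ := measure_ball_lt_top.ne
  refine ⟨((v / volume (Metric.ball (0 : E) 1)).toReal) ^ ((1 : ℝ) / Module.finrank ℝ E),
    by positivity, ?_⟩
  rw [Measure.addHaar_ball _ _ (by positivity), one_div,
    Real.rpow_inv_natCast_pow (by positivity) Module.finrank_pos.ne',
    ENNReal.ofReal_toReal (ENNReal.div_ne_top hv h0), ENNReal.div_mul_cancel h0 hf]

omit [Nontrivial E] in
theorem tripleConv_le_ball_of_subset_ball {A : Fin 3 → Set E} {R : ℝ} (hR : 0 < R)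
    (hA : ∀ i, MeasurableSet (A i)) (hAR : ∀ i, A i ⊆ Metric.ball 0 R) {r : Fin 3 → ℝ}
    (hr : ∀ i, r i ≤ R) (hAr : ∀ i, volume (A i) = volume (Metric.ball (0 : E) (r i))) :
    tripleConv volume (A 0) (A 1) (A 2) ≤ tripleConv volume (Metric.ball (0 : E) (r 0))
      (Metric.ball (0 : E) (r 1)) (Metric.ball (0 : E) (r 2)) := by
  set Q : Fin 3 → Set E := fun i => Metric.ball 0 (r i) with hQ
  have hQm : ∀ i, MeasurableSet (Q i) := fun i => Metric.isOpen_ball.measurableSet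
  set v := volume (Metric.ball (0 : E) R) with hv
  set V := 18 * volume (Metric.ball (0 : E) (2 * R)) with hV
  have hVf : V ≠ ∞ := ENNReal.mul_ne_top (by simp) measure_ball_lt_top.ne
  let ι := {B : Fin 3 → Set E // (∀ i, MeasurableSet (B i)) ∧ (∀ i, B i ⊆ Metric.ball 0 R) ∧
    (∀ i, volume (B i) = volume (A i)) ∧
    tripleConv volume (A 0) (A 1) (A 2) ≤ tripleConv volume (B 0) (B 1) (B 2)}
  have : Nonempty ι := ⟨⟨A, hA, hAR, fun _ => rfl, le_rfl⟩⟩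
  let Φ : ι → ℝ≥0∞ := fun B => ∑ i, volume (B.1 i \ Q i)
  have hΦf : ∀ B, Φ B ≠ ∞ := fun B => by
    refine ENNReal.sum_ne_top.2 fun i _ => ?_
    exact (measure_mono (Set.sdiff_subset.trans (B.2.2.1 i)) |>.trans_lt measure_ball_lt_top).ne
  have hstep : ∀ B : ι, ∃ B' : ι, Φ B' + Φ B ^ 2 / V ≤ Φ B := by
    rintro ⟨B, hBm, hBR, hBv, hBt⟩
    obtain ⟨j, hj⟩ : ∃ j, ∀ i, volume (B i \ Q i) ≤ volume (B j \ Q j) := Finite.exists_max _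
    obtain ⟨S, h1, h2, h3, h4, h5, h6⟩ := exists_steiner_gain (hBm j) hR (hBR j) (hr j)
      ((hBv j).trans (hAr j))
    refine ⟨⟨fun i => S (B i), fun i => h1 _ (hBm i), fun i => h5 _ (hBR i),
      fun i => (h2 _ (hBm i)).trans (hBv i), hBt.trans (h3 _ _ _ (hBm 0) (hBm 1) (hBm 2))⟩, ?_⟩
    have hsum : (∑ i, volume (B i \ Q i)) ≤ 3 * volume (B j \ Q j) := by
      simpa using Finset.sum_le_card_nsmul Finset.univ _ _ fun i _ => hj i
    change (∑ i, volume (S (B i) \ Q i)) + (∑ i, volume (B i \ Q i)) ^ 2 / V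
      ≤ ∑ i, volume (B i \ Q i)
    have hg : (∑ i, volume (B i \ Q i)) ^ 2 / V ≤ volume (B j \ Q j) ^ 2 /
        (2 * volume (Metric.ball (0 : E) (2 * R))) := by
      calc (∑ i, volume (B i \ Q i)) ^ 2 / V ≤ (3 * volume (B j \ Q j)) ^ 2 / V := by gcongr
        _ = _ := by
          rw [mul_pow, hV, show (18 : ℝ≥0∞) = 3 ^ 2 * 2 by norm_num, mul_assoc,
            ENNReal.mul_div_mul_left _ _ (by norm_num) (by simp)]
    refine (add_le_add_right hg _).trans ?_
    rw [← Finset.add_sum_erase _ (fun i => volume (S (B i) \ Q i)) (Finset.mem_univ j),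
      ← Finset.add_sum_erase _ (fun i => volume (B i \ Q i)) (Finset.mem_univ j),
      add_right_comm]
    exact add_le_add h6 (Finset.sum_le_sum fun i _ => h4 _ _ (hBm i))
  set D := ⨅ B, Φ B with hD
  have hDf : D ≠ ∞ := (iInf_le Φ ⟨A, hA, hAR, fun _ => rfl, le_rfl⟩ |>.trans_lt
    (hΦf _).lt_top).ne
  have hD0 : D = 0 := by
    have h1 : D + D ^ 2 / V ≤ D + 0 := by
      rw [add_zero]
      refine le_iInf fun B => ?_
      obtain ⟨B', hB'⟩ := hstep B
      refine le_trans ?_ hB'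
      gcongr
      · exact iInf_le Φ B'
      · exact iInf_le Φ B
    rw [ENNReal.add_le_add_iff_left hDf, nonpos_iff_eq_zero, ENNReal.div_eq_zero_iff] at h1
    simpa using h1.resolve_right hVf
  have hvf : v ≠ ∞ := measure_ball_lt_top.ne
  have hle : ∀ B : ι, tripleConv volume (A 0) (A 1) (A 2) ≤
      tripleConv volume (Q 0) (Q 1) (Q 2) + Φ B * v := by
    intro B
    refine B.2.2.2.2.trans ?_
    have := tripleConv_le_add_diff (μ := volume) (B.2.1 0) (B.2.1 1) (B.2.1 2) (hQm 0) (hQm 1)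
      (hQm 2) (measure_mono (B.2.2.1 1)) (measure_mono (Metric.ball_subset_ball (hr 0)))
    simpa [Φ, Fin.sum_univ_three] using this
  refine (le_iInf hle).trans ?_
  rw [← ENNReal.add_iInf, ← ENNReal.iInf_mul (fun h => absurd h hvf), ← hD, hD0, zero_mul, add_zero]

end InnerProduct

theorem tripleConv_eq_prod {G : Type*} [AddCommGroup G] [MeasurableSpace G] [MeasurableAdd₂ G]
    {μ : Measure G} [SFinite μ] {A B C : Set G} (hA : MeasurableSet A) (hB : MeasurableSet B)
    (hC : MeasurableSet C) :
    tripleConv μ A B C = (μ.prod μ) {p | p.1 ∈ A ∧ p.2 ∈ B ∧ p.1 + p.2 ∈ C} := by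
  have hm := measurable_tripleConv_integrand hA hB hC
  have hS : MeasurableSet {p : G × G | p.1 ∈ A ∧ p.2 ∈ B ∧ p.1 + p.2 ∈ C} :=
    (measurable_fst hA).inter ((measurable_snd hB).inter (measurable_add hC))
  rw [tripleConv, ← lintegral_indicator_one hS, lintegral_lintegral hm.aemeasurable]
  refine lintegral_congr fun p => ?_
  by_cases h1 : p.1 ∈ A <;> by_cases h2 : p.2 ∈ B <;> by_cases h3 : p.1 + p.2 ∈ C <;>
    simp [h1, h2, h3]

theorem tripleConv_iUnion_le {G : Type*} [AddCommGroup G] [MeasurableSpace G] [MeasurableAdd₂ G]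
    {μ : Measure G} [SFinite μ] {A B C : ℕ → Set G} (hA : ∀ n, MeasurableSet (A n))
    (hB : ∀ n, MeasurableSet (B n)) (hC : ∀ n, MeasurableSet (C n)) (hA' : Monotone A)
    (hB' : Monotone B) (hC' : Monotone C) {c : ℝ≥0∞}
    (h : ∀ n, tripleConv μ (A n) (B n) (C n) ≤ c) :
    tripleConv μ (⋃ n, A n) (⋃ n, B n) (⋃ n, C n) ≤ c := by
  rw [tripleConv_eq_prod (.iUnion hA) (.iUnion hB) (.iUnion hC)]
  have hsub : {p : G × G | p.1 ∈ ⋃ n, A n ∧ p.2 ∈ ⋃ n, B n ∧ p.1 + p.2 ∈ ⋃ n, C n}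
      ⊆ ⋃ n, {p : G × G | p.1 ∈ A n ∧ p.2 ∈ B n ∧ p.1 + p.2 ∈ C n} := by
    rintro p ⟨h1, h2, h3⟩
    obtain ⟨i, hi⟩ := Set.mem_iUnion.1 h1
    obtain ⟨j, hj⟩ := Set.mem_iUnion.1 h2
    obtain ⟨k, hk⟩ := Set.mem_iUnion.1 h3
    exact Set.mem_iUnion.2 ⟨i ⊔ j ⊔ k, hA' (by omega) hi, hB' (by omega) hj, hC' (by omega) hk⟩
  refine (measure_mono hsub).trans ?_
  rw [Monotone.measure_iUnion]
  · refine iSup_le fun n => ?_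
    rw [← tripleConv_eq_prod (hA n) (hB n) (hC n)]
    exact h n
  · exact fun m n hmn p hp => ⟨hA' hmn hp.1, hB' hmn hp.2.1, hC' hmn hp.2.2⟩

section InnerProduct

variable {E : Type*} [NormedAddCommGroup E] [InnerProductSpace ℝ E] [FiniteDimensional ℝ E]
  [MeasurableSpace E] [BorelSpace E]

variable (E) in
/-- The open ball centered at `0` of volume `v`, with the convention that it is the whole space
when `v = ∞`. -/
def centeredBall (v : ℝ≥0∞) : Set E := {x | volume (Metric.ball (0 : E) ‖x‖) < v}

theorem measurable_volume_ball_norm : Measurable fun x : E => volume (Metric.ball (0 : E) ‖x‖) := by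
  have : Monotone fun r : ℝ => volume (Metric.ball (0 : E) r) :=
    fun r s h => measure_mono (Metric.ball_subset_ball h)
  exact this.measurable.comp measurable_norm

theorem measurableSet_centeredBall (v : ℝ≥0∞) : MeasurableSet (centeredBall E v) :=
  measurableSet_lt measurable_volume_ball_norm measurable_const

theorem centeredBall_mono {v w : ℝ≥0∞} (h : v ≤ w) : centeredBall E v ⊆ centeredBall E w :=
  fun _ hx => lt_of_lt_of_le hx h

theorem centeredBall_top : centeredBall E ∞ = Set.univ := by
  ext; simp [centeredBall, measure_ball_lt_top]

variable [Nontrivial E]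

theorem volume_ball_lt_iff {r s : ℝ} (hr : 0 ≤ r) (hs : 0 ≤ s) :
    volume (Metric.ball (0 : E) r) < volume (Metric.ball (0 : E) s) ↔ r < s := by
  have h0 : volume (Metric.ball (0 : E) 1) ≠ 0 :=
    (Metric.measure_ball_pos volume (0 : E) one_pos).ne'
  have hf : volume (Metric.ball (0 : E) 1) ≠ ∞ := measure_ball_lt_top.ne
  rw [Measure.addHaar_ball _ _ hr, Measure.addHaar_ball _ _ hs,
    ENNReal.mul_lt_mul_iff_left h0 hf, ENNReal.ofReal_lt_ofReal_iff_of_nonneg (by positivity),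
    pow_lt_pow_iff_left₀ hr hs Module.finrank_pos.ne']

theorem centeredBall_volume_ball {r : ℝ} (hr : 0 ≤ r) :
    centeredBall E (volume (Metric.ball (0 : E) r)) = Metric.ball 0 r := by
  ext x
  rw [mem_ball_zero_iff]
  exact volume_ball_lt_iff (norm_nonneg x) hr

theorem volume_centeredBall (v : ℝ≥0∞) : volume (centeredBall E v) = v := by
  rcases eq_or_ne v ∞ with rfl | hv
  · have : NoncompactSpace E := NormedSpace.noncompactSpace ℝ E
    rw [centeredBall_top, measure_univ_of_isAddLeftInvariant]
  · obtain ⟨r, hr, rfl⟩ := exists_volume_ball_eq (E := E) hv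
    rw [centeredBall_volume_ball hr]

/-- **Riesz rearrangement inequality** for sets. -/
theorem tripleConv_le_centeredBall {A B C : Set E} (hA : MeasurableSet A) (hB : MeasurableSet B)
    (hC : MeasurableSet C) :
    tripleConv volume A B C ≤ tripleConv volume (centeredBall E (volume A))
      (centeredBall E (volume B)) (centeredBall E (volume C)) := by
  have key : ∀ n : ℕ, tripleConv volume (A ∩ Metric.ball 0 n) (B ∩ Metric.ball 0 n)
      (C ∩ Metric.ball 0 n) ≤ tripleConv volume (centeredBall E (volume A))
      (centeredBall E (volume B)) (centeredBall E (volume C)) := by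
    intro n
    rcases Nat.eq_zero_or_pos n with rfl | hn
    · simp [tripleConv]
    let T : Fin 3 → Set E := ![A, B, C]
    have hT : ∀ i, MeasurableSet (T i) := fun i => by fin_cases i <;> simp [T, *]
    have hfin : ∀ i, volume (T i ∩ Metric.ball 0 n) ≠ ∞ := fun i =>
      (measure_mono Set.inter_subset_right |>.trans_lt measure_ball_lt_top).ne
    choose r hr0 hr using fun i => exists_volume_ball_eq (E := E) (hfin i)
    have h := tripleConv_le_ball_of_subset_ball (A := fun i => T i ∩ Metric.ball 0 n)
      (R := n) (by exact_mod_cast hn) (fun i => (hT i).inter Metric.isOpen_ball.measurableSet)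
      (fun i => Set.inter_subset_right) (r := r) (fun i => ?_) (fun i => (hr i).symm)
    · refine h.trans (tripleConv_mono ?_ ?_ ?_)
      all_goals
        rw [← centeredBall_volume_ball (hr0 _), hr]
        exact centeredBall_mono (measure_mono Set.inter_subset_left)
    · rw [← not_lt, ← volume_ball_lt_iff (E := E) (Nat.cast_nonneg n) (hr0 i), not_lt, hr]
      exact measure_mono Set.inter_subset_right
  have hU : ∀ A : Set E, ⋃ n : ℕ, A ∩ Metric.ball 0 n = A := fun A => by
    rw [← Set.inter_iUnion, Metric.iUnion_ball_nat, Set.inter_univ]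
  have hm : ∀ A : Set E, Monotone fun n : ℕ => A ∩ Metric.ball 0 (n : ℝ) := fun A m n h =>
    Set.inter_subset_inter_right _ (Metric.ball_subset_ball (by exact_mod_cast h))
  have hb : ∀ n : ℕ, MeasurableSet (Metric.ball (0 : E) n) := fun n =>
    Metric.isOpen_ball.measurableSet
  rw [← hU A, ← hU B, ← hU C]
  refine tripleConv_iUnion_le (fun n => hA.inter (hb n)) (fun n => hB.inter (hb n))
    (fun n => hC.inter (hb n)) (hm A) (hm B) (hm C) fun n => ?_
  rw [hU, hU, hU]
  exact key n

end InnerProduct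

/-- The super-level set `{h > t}`. -/
def superlevel {X : Type*} (h : X → ℝ≥0∞) (t : ℝ) : Set X := {x | ENNReal.ofReal t < h x}

theorem superlevel_anti {X : Type*} (h : X → ℝ≥0∞) : Antitone (superlevel h) :=
  fun _ _ hst _ hx => (ENNReal.ofReal_le_ofReal hst).trans_lt hx

section LayerCake

variable {X : Type*} [MeasurableSpace X]

theorem measurableSet_superlevel {h : X → ℝ≥0∞} (hh : Measurable h) (t : ℝ) :
    MeasurableSet (superlevel h t) := measurableSet_lt measurable_const hh

omit [MeasurableSpace X] in
theorem eq_lintegral_superlevel (h : X → ℝ≥0∞) (x : X) :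
    h x = ∫⁻ t in Set.Ioi (0 : ℝ), (superlevel h t).indicator 1 x := by
  have h1 : ∀ t : ℝ, (superlevel h t).indicator (1 : X → ℝ≥0∞) x
      = {t : ℝ | ENNReal.ofReal t < h x}.indicator 1 t := fun t => rfl
  simp_rw [h1]
  have hm : MeasurableSet {t : ℝ | ENNReal.ofReal t < h x} :=
    measurableSet_lt (by fun_prop) measurable_const
  rw [lintegral_indicator_one hm, Measure.restrict_apply hm]
  rcases eq_or_ne (h x) ∞ with hx | hx
  · have : {t : ℝ | ENNReal.ofReal t < h x} = Set.univ := by ext; simp [hx]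
    rw [this, Set.univ_inter, Real.volume_Ioi, hx]
  · have : {t : ℝ | ENNReal.ofReal t < h x} ∩ Set.Ioi 0 = Set.Ioo 0 (h x).toReal := by
      ext t
      simp only [Set.mem_inter_iff, Set.mem_ofPred_eq, Set.mem_Ioi, Set.mem_Ioo]
      rw [and_comm]
      refine and_congr_right fun ht => ?_
      rw [ENNReal.ofReal_lt_iff_lt_toReal ht.le hx]
    rw [this, Real.volume_Ioo, sub_zero, ENNReal.ofReal_toReal hx]

theorem lintegral_family_mul {μ : Measure X} [SFinite μ] {P : Set (ℝ × X)} (hP : MeasurableSet P)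
    {u : X → ℝ≥0∞} (hu : Measurable u) :
    ∫⁻ x, (∫⁻ t in Set.Ioi (0 : ℝ), {x | (t, x) ∈ P}.indicator 1 x) * u x ∂μ =
      ∫⁻ t in Set.Ioi (0 : ℝ), ∫⁻ x in {x | (t, x) ∈ P}, u x ∂μ := by
  have hP' : Measurable fun q : X × ℝ => ({x | (q.2, x) ∈ P}.indicator 1 q.1 : ℝ≥0∞) :=
    (measurable_indicator_one' hP).comp measurable_swap
  have h1 : ∀ x, Measurable fun t : ℝ => ({x | (t, x) ∈ P}.indicator 1 x : ℝ≥0∞) := fun x =>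
    hP'.comp measurable_prodMk_left
  simp_rw [← lintegral_mul_const _ (h1 _)]
  rw [lintegral_lintegral_swap (hP'.mul (hu.comp measurable_fst)).aemeasurable]
  refine lintegral_congr fun t => ?_
  have hPt : MeasurableSet {x | (t, x) ∈ P} := measurable_prodMk_left hP
  rw [← lintegral_indicator hPt]
  refine lintegral_congr fun x => ?_
  by_cases hx : (t, x) ∈ P <;> simp [hx]

theorem lintegral_mul_eq_superlevel {μ : Measure X} [SFinite μ] {h u : X → ℝ≥0∞}
    (hh : Measurable h) (hu : Measurable u) :
    ∫⁻ x, h x * u x ∂μ = ∫⁻ t in Set.Ioi (0 : ℝ), ∫⁻ x in superlevel h t, u x ∂μ := by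
  have hP : MeasurableSet {p : ℝ × X | ENNReal.ofReal p.1 < h p.2} :=
    measurableSet_lt (by fun_prop) (by fun_prop)
  refine Eq.trans ?_ (lintegral_family_mul hP hu)
  refine lintegral_congr fun x => ?_
  rw [eq_lintegral_superlevel h x]
  rfl

theorem lintegral_eq_superlevel {μ : Measure X} [SFinite μ] {h : X → ℝ≥0∞} (hh : Measurable h) :
    ∫⁻ x, h x ∂μ = ∫⁻ t in Set.Ioi (0 : ℝ), μ (superlevel h t) := by
  simpa using lintegral_mul_eq_superlevel (μ := μ) hh measurable_one

end LayerCake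

section InnerProduct

variable {E : Type*} [NormedAddCommGroup E] [InnerProductSpace ℝ E] [FiniteDimensional ℝ E]
  [MeasurableSpace E] [BorelSpace E]

/-- The symmetric decreasing rearrangement of `h`. -/
noncomputable def rearrange (h : E → ℝ≥0∞) (x : E) : ℝ≥0∞ :=
  ∫⁻ t in Set.Ioi (0 : ℝ), (centeredBall E (volume (superlevel h t))).indicator 1 x

theorem volume_superlevel_anti (h : E → ℝ≥0∞) : Antitone fun t => volume (superlevel h t) :=
  fun _ _ hst => measure_mono (superlevel_anti h hst)

theorem measurableSet_rearrange_family (h : E → ℝ≥0∞) :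
    MeasurableSet {p : ℝ × E | p.2 ∈ centeredBall E (volume (superlevel h p.1))} :=
  measurableSet_lt (measurable_volume_ball_norm.comp measurable_snd)
    ((volume_superlevel_anti h).measurable.comp measurable_fst)

theorem measurable_rearrange (h : E → ℝ≥0∞) : Measurable (rearrange h) := by
  have : Measurable fun q : E × ℝ => ((centeredBall E (volume (superlevel h q.2))).indicator 1 q.1
      : ℝ≥0∞) := (measurable_indicator_one' (measurableSet_rearrange_family h)).comp measurable_swap
  exact this.lintegral_prod_right'

theorem lintegral_rearrange_mul {μ : Measure E} [SFinite μ] (h : E → ℝ≥0∞) {u : E → ℝ≥0∞}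
    (hu : Measurable u) :
    ∫⁻ x, rearrange h x * u x ∂μ =
      ∫⁻ t in Set.Ioi (0 : ℝ), ∫⁻ x in centeredBall E (volume (superlevel h t)), u x ∂μ :=
  lintegral_family_mul (measurableSet_rearrange_family h) hu

/-- `G` dominates `g` in the sense that integrals of `g` over sets are bounded by
integrals of `G` over centered balls of the same volume. -/
def Majorized (g G : E → ℝ≥0∞) : Prop :=
  ∀ A, MeasurableSet A → volume A ≠ ∞ → ∫⁻ x in A, g x ≤ ∫⁻ x in centeredBall E (volume A), G x

theorem Majorized.mul {g G h : E → ℝ≥0∞} (hgG : Majorized g G) (hh : Measurable h)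
    (hg : Measurable g) (hG : Measurable G) :
    Majorized (fun x => h x * g x) (fun x => rearrange h x * G x) := by
  intro A hA hAf
  rw [lintegral_mul_eq_superlevel hh hg, lintegral_rearrange_mul h hG]
  refine lintegral_mono fun t => ?_
  have hm := measurableSet_superlevel hh t
  rw [Measure.restrict_restrict hm, Measure.restrict_restrict (measurableSet_centeredBall _)]
  refine (hgG _ (hm.inter hA) (measure_mono Set.inter_subset_right |>.trans_lt hAf.lt_top).ne).trans
    (lintegral_mono_set (Set.subset_inter ?_ ?_))
  · exact centeredBall_mono (measure_mono Set.inter_subset_left)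
  · exact centeredBall_mono (measure_mono Set.inter_subset_right)

theorem Majorized.lintegral_mul_comp_add_le {g G h : E → ℝ≥0∞} (hgG : Majorized g G)
    (hh : Measurable h) (hg : Measurable g) (hG : Measurable G)
    (hf : ∀ t, 0 < t → volume (superlevel h t) ≠ ∞) (x₀ : E) :
    ∫⁻ y, h y * g (x₀ + y) ≤ ∫⁻ y, rearrange h y * G y := by
  have hgx : Measurable fun y => g (x₀ + y) := hg.comp (measurable_const_add x₀)
  rw [lintegral_mul_eq_superlevel hh hgx,
    lintegral_rearrange_mul h hG]
  refine setLIntegral_mono' measurableSet_Ioi fun t ht => ?_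
  have hm := measurableSet_superlevel hh t
  have hv : volume ((-x₀ + ·) ⁻¹' superlevel h t) = volume (superlevel h t) :=
    measure_preimage_add _ _ _
  rw [← hv]
  refine le_trans (le_of_eq ?_) (hgG _ (measurable_const_add _ hm) (hv ▸ hf t ht))
  rw [← lintegral_indicator hm, ← lintegral_indicator (measurable_const_add (-x₀) hm),
    ← lintegral_add_left_eq_self (((-x₀ + ·) ⁻¹' superlevel h t).indicator g) x₀]
  refine lintegral_congr fun y => ?_
  have hy : x₀ + y ∈ (-x₀ + ·) ⁻¹' superlevel h t ↔ y ∈ superlevel h t := by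
    rw [Set.mem_preimage, neg_add_cancel_left]
  by_cases h1 : y ∈ superlevel h t
  · rw [Set.indicator_of_mem h1, Set.indicator_of_mem (hy.2 h1)]
  · rw [Set.indicator_of_notMem h1, Set.indicator_of_notMem (mt hy.1 h1)]

variable [Nontrivial E]

theorem majorized_one : Majorized (1 : E → ℝ≥0∞) 1 := by
  intro A _ _
  simp [volume_centeredBall]

end InnerProduct

section InnerProduct

variable {E : Type*} [NormedAddCommGroup E] [InnerProductSpace ℝ E] [FiniteDimensional ℝ E]
  [MeasurableSpace E] [BorelSpace E] [Nontrivial E]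

theorem exists_subset_volume_eq {D : Set E} {t : ℝ≥0∞} (ht : t < volume D) :
    ∃ C ⊆ D, (MeasurableSet D → MeasurableSet C) ∧ volume C = t := by
  rcases eq_zero_or_pos t with rfl | ht0
  · exact ⟨∅, Set.empty_subset _, fun _ => .empty, measure_empty⟩
  obtain ⟨n, hn⟩ : ∃ n : ℕ, t < volume (D ∩ Metric.ball 0 n) := by
    have hmono : Monotone fun n : ℕ => D ∩ Metric.ball 0 (n : ℝ) := fun m n h =>
      Set.inter_subset_inter_right _ (Metric.ball_subset_ball (by exact_mod_cast h))
    rw [← Set.inter_univ D, ← Metric.iUnion_ball_nat (0 : E), Set.inter_iUnion,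
      hmono.measure_iUnion] at ht
    exact lt_iSup_iff.1 ht
  set F := D ∩ Metric.ball 0 (n : ℝ)
  have hF : volume F < ∞ := measure_mono Set.inter_subset_right |>.trans_lt measure_ball_lt_top
  have : IsFiniteMeasure (volume.restrict F) := ⟨by simpa using hF⟩
  set ν := (volume.restrict F).map (fun x : E => ‖x‖) with hν
  have : NullSingletonClass ν := by
    refine ⟨fun r => ?_⟩
    rw [hν, Measure.map_apply measurable_norm (measurableSet_singleton r)]
    refine le_antisymm ((Measure.restrict_apply_le _ _).trans (le_of_eq ?_)) bot_le
    have := Measure.addHaar_sphere (volume : Measure E) 0 r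
    convert this using 2
    ext x; simp
  obtain ⟨r, hr⟩ := exists_measure_Iio_eq ν ht0 (by
    rwa [hν, Measure.map_apply measurable_norm .univ, Set.preimage_univ,
      Measure.restrict_apply .univ, Set.univ_inter])
  have hm : MeasurableSet ((fun x : E => ‖x‖) ⁻¹' Set.Iio r) := measurable_norm measurableSet_Iio
  rw [hν, Measure.map_apply measurable_norm measurableSet_Iio, Measure.restrict_apply hm] at hr
  exact ⟨_, Set.inter_subset_right.trans Set.inter_subset_left, fun hD =>
    hm.inter (hD.inter Metric.isOpen_ball.measurableSet), hr⟩

theorem exists_between_volume_eq {E₁ E₂ : Set E} (h₁ : MeasurableSet E₁) (h₂ : MeasurableSet E₂)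
    (h : E₁ ⊆ E₂) {β : ℝ≥0∞} (hβ : β ≠ ∞) (h1 : volume E₁ ≤ β) (h2 : β < volume E₂) :
    ∃ C, MeasurableSet C ∧ E₁ ⊆ C ∧ C ⊆ E₂ ∧ volume C = β := by
  have hf : volume E₁ ≠ ∞ := (h1.trans_lt hβ.lt_top).ne
  obtain ⟨C, hC, hCm, hCv⟩ := exists_subset_volume_eq (D := E₂ \ E₁) (t := β - volume E₁) (by
    rwa [measure_sdiff h h₁.nullMeasurableSet hf, lt_tsub_iff_right, tsub_add_cancel_of_le h1])
  refine ⟨E₁ ∪ C, h₁.union (hCm (h₂.diff h₁)), Set.subset_union_left,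
    Set.union_subset h (hC.trans Set.sdiff_subset), ?_⟩
  rw [measure_union (Set.disjoint_left.2 fun x hx hx' => (hC hx').2 hx) (hCm (h₂.diff h₁)), hCv,
    add_tsub_cancel_of_le h1]

omit [Nontrivial E] in
theorem Majorized.lintegral_inter_superlevel_le {g G : E → ℝ≥0∞} (hgG : Majorized g G)
    (hg : Measurable g) {C : Set E} (hC : MeasurableSet C) {β : ℝ≥0∞} (hβ : β ≠ ∞)
    (hCβ : volume C ≤ β) :
    ∫⁻ s in Set.Ioi (0 : ℝ), volume (superlevel g s ∩ C) ≤ ∫⁻ x in centeredBall E β, G x := by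
  calc _ = ∫⁻ x in C, g x := by
        rw [lintegral_eq_superlevel hg]
        refine lintegral_congr fun s => ?_
        rw [Measure.restrict_apply (measurableSet_superlevel hg s)]
    _ ≤ ∫⁻ x in centeredBall E (volume C), G x := hgG C hC (hCβ.trans_lt hβ.lt_top).ne
    _ ≤ _ := lintegral_mono_set (centeredBall_mono hCβ)

/-- The integral of `min(|{g > s}|, β)` is the supremum of the integrals of `g` over sets of
volume at most `β`. -/
theorem Majorized.lintegral_min_le {g G : E → ℝ≥0∞} (hgG : Majorized g G)
    (hg : Measurable g) {β : ℝ≥0∞} (hβ : β ≠ ∞) :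
    ∫⁻ s in Set.Ioi (0 : ℝ), min (volume (superlevel g s)) β ≤
      ∫⁻ x in centeredBall E β, G x := by
  have hgm := measurableSet_superlevel hg
  have key : ∀ ε : ℝ, 0 < ε → ∫⁻ s in Set.Ioi (0 : ℝ), min (volume (superlevel g s)) β ≤
      (∫⁻ x in centeredBall E β, G x) + ENNReal.ofReal ε * β := by
    intro ε hε
    by_cases hex : ∃ k : ℕ, volume (superlevel g (k * ε)) ≤ β
    · classical
      obtain ⟨k, hk, hmin⟩ : ∃ k : ℕ, volume (superlevel g (k * ε)) ≤ β ∧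
          ∀ j < k, ¬ volume (superlevel g (j * ε)) ≤ β :=
        ⟨Nat.find hex, Nat.find_spec hex, fun j hj => Nat.find_min hex hj⟩
      rcases k with _ | k
      · refine le_trans ?_ le_self_add
        refine le_trans ?_ (hgG.lintegral_inter_superlevel_le hg (hgm 0) hβ (by simpa using hk))
        refine setLIntegral_mono' measurableSet_Ioi fun s hs => (min_le_left _ _).trans ?_
        rw [Set.inter_eq_left.2 (superlevel_anti g (le_of_lt hs))]
      · have hk1 := not_le.1 (hmin k k.lt_succ_self)
        have hle : (k : ℝ) * ε ≤ (k + 1 : ℕ) * ε := by gcongr; simp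
        obtain ⟨C, hC, hC1, hC2, hCv⟩ := exists_between_volume_eq (hgm _) (hgm _)
          (superlevel_anti g hle) hβ hk hk1
        calc ∫⁻ s in Set.Ioi (0 : ℝ), min (volume (superlevel g s)) β
            ≤ ∫⁻ s in Set.Ioi (0 : ℝ), (volume (superlevel g s ∩ C) +
              (Set.Ico (k * ε) ((k + 1 : ℕ) * ε)).indicator (fun _ => β) s) := by
              refine lintegral_mono fun s => ?_
              rcases le_or_gt ((k + 1 : ℕ) * ε) s with h | h
              · refine (min_le_left _ _).trans (le_trans (le_of_eq ?_) le_self_add)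
                rw [Set.inter_eq_left.2 ((superlevel_anti g h).trans hC1)]
              · rcases le_or_gt (k * ε) s with h' | h'
                · rw [Set.indicator_of_mem (Set.mem_Ico.2 ⟨h', h⟩)]
                  exact (min_le_right _ _).trans le_add_self
                · refine (min_le_right _ _).trans (le_trans (le_of_eq ?_) le_self_add)
                  rw [Set.inter_eq_right.2 (hC2.trans (superlevel_anti g h'.le)), hCv]
          _ = (∫⁻ s in Set.Ioi (0 : ℝ), volume (superlevel g s ∩ C)) +
              ∫⁻ s in Set.Ioi (0 : ℝ), (Set.Ico (k * ε) ((k + 1 : ℕ) * ε)).indicator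
                (fun _ => β) s :=
              lintegral_add_right _ (measurable_const.indicator measurableSet_Ico)
          _ ≤ _ := by
              gcongr
              · exact hgG.lintegral_inter_superlevel_le hg hC hβ hCv.le
              · refine (setLIntegral_le_lintegral _ _).trans ?_
                rw [lintegral_indicator measurableSet_Ico, setLIntegral_const, Real.volume_Ico,
                  mul_comm, ← sub_mul]
                simp
    · push Not at hex
      rcases eq_or_ne β 0 with rfl | hβ0
      · simp
      suffices h : ∫⁻ x in centeredBall E β, G x = ∞ by simp [h]
      have h1 : ∀ k : ℕ, ENNReal.ofReal (k * ε) * β ≤ ∫⁻ x in centeredBall E β, G x := by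
        intro k
        obtain ⟨C, hC, hCm, hCv⟩ := exists_subset_volume_eq (hex k)
        rw [← hCv]
        refine le_trans ?_ (hgG C (hCm (hgm _)) (hCv ▸ hβ))
        rw [← setLIntegral_const]
        exact setLIntegral_mono' (hCm (hgm _)) fun x hx => (hC hx).le
      refine top_unique (le_of_tendsto' (?_ : Tendsto (fun k : ℕ => ENNReal.ofReal (k * ε) * β)
        atTop (𝓝 ∞)) h1)
      have h2 : Tendsto (fun k : ℕ => ENNReal.ofReal (k * ε)) atTop (𝓝 ∞) :=
        ENNReal.tendsto_ofReal_atTop.comp (tendsto_natCast_atTop_atTop.atTop_mul_const hε)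
      simpa [ENNReal.top_mul hβ0] using ENNReal.Tendsto.mul_const h2 (Or.inl (by simp) : ∞ ≠ 0 ∨ β ≠ ∞)
  have hlim : Tendsto (fun ε : ℝ => (∫⁻ x in centeredBall E β, G x) + ENNReal.ofReal ε * β)
      (𝓝[>] 0) (𝓝 ((∫⁻ x in centeredBall E β, G x) + ENNReal.ofReal 0 * β)) := by
    refine Tendsto.mono_left ?_ nhdsWithin_le_nhds
    exact tendsto_const_nhds.add (ENNReal.Tendsto.mul_const
      (ENNReal.tendsto_ofReal tendsto_id) (Or.inr hβ))
  simpa using ge_of_tendsto hlim (eventually_mem_nhdsWithin.mono key)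

end InnerProduct

section InnerProduct

variable {E : Type*} [NormedAddCommGroup E] [InnerProductSpace ℝ E] [FiniteDimensional ℝ E]
  [MeasurableSpace E] [BorelSpace E]

/-- The convolution of the indicators of `A` and `B`. -/
noncomputable def indicatorConv (A B : Set E) (z : E) : ℝ≥0∞ :=
  ∫⁻ x, A.indicator 1 x * B.indicator 1 (z - x)

theorem measurable_indicatorConv_integrand {A B : Set E} (hA : MeasurableSet A)
    (hB : MeasurableSet B) :
    Measurable fun p : E × E => (A.indicator 1 p.2 * B.indicator 1 (p.1 - p.2) : ℝ≥0∞) :=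
  ((measurable_indicator_one' hA).comp measurable_snd).mul
    ((measurable_indicator_one' hB).comp (measurable_fst.sub measurable_snd))

theorem measurable_indicatorConv {A B : Set E} (hA : MeasurableSet A) (hB : MeasurableSet B) :
    Measurable (indicatorConv A B) :=
  (measurable_indicatorConv_integrand hA hB).lintegral_prod_right'

theorem setLIntegral_setLIntegral_add {A B : Set E} (hA : MeasurableSet A) (hB : MeasurableSet B)
    {g : E → ℝ≥0∞} (hg : Measurable g) :
    ∫⁻ x in A, ∫⁻ y in B, g (x + y) = ∫⁻ z, indicatorConv A B z * g z := by
  have hF : Measurable (Function.uncurry fun x y : E =>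
      (A.indicator 1 x * B.indicator 1 y * g (x + y) : ℝ≥0∞)) :=
    (((measurable_indicator_one' hA).comp measurable_fst).mul
      ((measurable_indicator_one' hB).comp measurable_snd)).mul (hg.comp measurable_add)
  calc ∫⁻ x in A, ∫⁻ y in B, g (x + y)
      = ∫⁻ x, ∫⁻ y, A.indicator 1 x * B.indicator 1 y * g (x + y) := by
        rw [← lintegral_indicator hA]
        refine lintegral_congr fun x => ?_
        by_cases hx : x ∈ A
        · rw [Set.indicator_of_mem hx, ← lintegral_indicator hB]
          refine lintegral_congr fun y => ?_
          by_cases hy : y ∈ B <;> simp [hx, hy]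
        · simp [hx]
    _ = ∫⁻ z, ∫⁻ x, A.indicator 1 x * B.indicator 1 (z - x) * g (x + (z - x)) :=
        lintegral_lintegral_sub_swap hF
    _ = _ := by
        refine lintegral_congr fun z => ?_
        simp only [add_sub_cancel]
        exact lintegral_mul_const _
          ((measurable_indicatorConv_integrand hA hB).comp measurable_prodMk_left)

theorem setLIntegral_indicatorConv {A B C : Set E} (hA : MeasurableSet A) (hB : MeasurableSet B)
    (hC : MeasurableSet C) : ∫⁻ z in C, indicatorConv A B z = tripleConv volume A B C := by
  rw [tripleConv_eq_lintegral_sum hA hB hC, ← lintegral_indicator hC]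
  refine lintegral_congr fun z => ?_
  by_cases hz : z ∈ C <;> simp [hz, indicatorConv]

theorem volume_superlevel_indicatorConv_ne_top {A B : Set E} (hA : MeasurableSet A)
    (hB : MeasurableSet B) (hAf : volume A ≠ ∞) (hBf : volume B ≠ ∞) {τ : ℝ} (hτ : 0 < τ) :
    volume (superlevel (indicatorConv A B) τ) ≠ ∞ := by
  intro h
  have h1 : ENNReal.ofReal τ * volume (superlevel (indicatorConv A B) τ) ≤ volume A * volume B := by
    refine le_trans ?_ (tripleConv_le_mul_left A B Set.univ hA hB)
    rw [← setLIntegral_indicatorConv hA hB .univ, Measure.restrict_univ, ← setLIntegral_const]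
    refine le_trans (setLIntegral_mono' (measurableSet_superlevel
      (measurable_indicatorConv hA hB) τ) fun x hx => le_of_lt hx) (setLIntegral_le_lintegral _ _)
  rw [h, ENNReal.mul_top (by simpa using hτ)] at h1
  exact ENNReal.mul_ne_top hAf hBf (top_unique h1)

variable [Nontrivial E]

/-- The super-level sets of the convolution of two centered balls are centered balls. -/
theorem superlevel_indicatorConv_ae_eq {a b : ℝ≥0∞} (ha : a ≠ ∞) (hb : b ≠ ∞) {τ : ℝ}
    (hτ : 0 < τ) :
    superlevel (indicatorConv (centeredBall E a) (centeredBall E b)) τ =ᵐ[volume]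
      centeredBall E (volume (superlevel (indicatorConv (centeredBall E a)
        (centeredBall E b)) τ)) := by
  have hA := measurableSet_centeredBall (E := E) a
  have hB := measurableSet_centeredBall (E := E) b
  have hH := measurable_indicatorConv hA hB
  have hfin := volume_superlevel_indicatorConv_ne_top hA hB
    (by rwa [volume_centeredBall]) (by rwa [volume_centeredBall]) hτ
  set H := indicatorConv (centeredBall E a) (centeredBall E b) with hHdef
  set L := superlevel H τ with hL
  have hLm : MeasurableSet L := measurableSet_superlevel hH τ
  set Q := centeredBall E (volume L) with hQ
  have hQm : MeasurableSet Q := measurableSet_centeredBall _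
  have hHfin : ∀ C, ∫⁻ z in C, H z ≠ ∞ := fun C => by
    refine (lt_of_le_of_lt (setLIntegral_le_lintegral _ _) ?_).ne
    rw [← setLIntegral_univ, setLIntegral_indicatorConv hA hB .univ]
    refine (tripleConv_le_mul_left _ _ _ hA hB).trans_lt ?_
    rw [volume_centeredBall, volume_centeredBall]
    exact ENNReal.mul_lt_top ha.lt_top hb.lt_top
  have h1 : ∫⁻ z in L, H z ≤ ∫⁻ z in Q, H z := by
    rw [setLIntegral_indicatorConv hA hB hLm, setLIntegral_indicatorConv hA hB hQm]
    have := tripleConv_le_centeredBall hA hB hLm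
    rwa [volume_centeredBall, volume_centeredBall] at this
  rw [← lintegral_inter_add_sdiff H L hQm, ← lintegral_inter_add_sdiff H Q hLm, Set.inter_comm Q L,
    ENNReal.add_le_add_iff_left (hHfin _)] at h1
  have hv : volume (Q \ L) = volume (L \ Q) :=
    volume_diff_comm hLm hQm (volume_centeredBall _).symm hfin
  have h2 : ∫⁻ z in Q \ L, H z ≤ ∫⁻ _ in L \ Q, ENNReal.ofReal τ := by
    rw [setLIntegral_const, ← hv, ← setLIntegral_const]
    exact setLIntegral_mono' (hQm.diff hLm) fun z hz => not_lt.1 hz.2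
  have h0 : volume (L \ Q) = 0 := by
    by_contra h0
    refine (h1.trans h2).not_gt (setLIntegral_strict_mono (hLm.diff hQm) h0 hH ?_ ?_)
    · rw [setLIntegral_const]
      exact ENNReal.mul_ne_top (by simp)
        (measure_mono Set.sdiff_subset |>.trans_lt hfin.lt_top).ne
    · exact Eventually.of_forall fun z hz => hz.1
  exact ae_eq_set.2 ⟨h0, hv.trans h0⟩

theorem Majorized.setLIntegral_add_le {g G : E → ℝ≥0∞} (hgG : Majorized g G) (hg : Measurable g)
    (hG : Measurable G) {A B : Set E} (hA : MeasurableSet A) (hB : MeasurableSet B)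
    (hAf : volume A ≠ ∞) (hBf : volume B ≠ ∞) :
    ∫⁻ x in A, ∫⁻ y in B, g (x + y) ≤
      ∫⁻ x in centeredBall E (volume A), ∫⁻ y in centeredBall E (volume B), G (x + y) := by
  have hA' := measurableSet_centeredBall (E := E) (volume A)
  have hB' := measurableSet_centeredBall (E := E) (volume B)
  have hK := measurable_indicatorConv hA hB
  have hH := measurable_indicatorConv hA' hB'
  rw [setLIntegral_setLIntegral_add hA hB hg, setLIntegral_setLIntegral_add hA' hB' hG]
  have hfin : ∀ τ : ℝ, 0 < τ → volume (superlevel (indicatorConv (centeredBall E (volume A))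
      (centeredBall E (volume B))) τ) ≠ ∞ := fun τ hτ =>
    volume_superlevel_indicatorConv_ne_top hA' hB'
      (by rwa [volume_centeredBall]) (by rwa [volume_centeredBall]) hτ
  have hae := fun τ : ℝ => superlevel_indicatorConv_ae_eq (E := E) hAf hBf (τ := τ)
  set H := indicatorConv (centeredBall E (volume A)) (centeredBall E (volume B))
  calc ∫⁻ z, indicatorConv A B z * g z = ∫⁻ z, g z * indicatorConv A B z := by
        simp_rw [mul_comm]
    _ = ∫⁻ s in Set.Ioi (0 : ℝ), tripleConv volume A B (superlevel g s) := by
        rw [lintegral_mul_eq_superlevel hg hK]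
        refine lintegral_congr fun s => ?_
        rw [setLIntegral_indicatorConv hA hB (measurableSet_superlevel hg s)]
    _ ≤ ∫⁻ s in Set.Ioi (0 : ℝ), ∫⁻ τ in Set.Ioi (0 : ℝ),
          min (volume (superlevel g s)) (volume (superlevel H τ)) := by
        refine lintegral_mono fun s => ?_
        refine (tripleConv_le_centeredBall hA hB (measurableSet_superlevel hg s)).trans ?_
        rw [← setLIntegral_indicatorConv hA' hB' (measurableSet_centeredBall _),
          lintegral_eq_superlevel hH]
        refine lintegral_mono fun τ => ?_
        rw [Measure.restrict_apply (measurableSet_superlevel hH τ)]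
        refine le_min ((measure_mono Set.inter_subset_right).trans (volume_centeredBall _).le)
          (measure_mono Set.inter_subset_left)
    _ = ∫⁻ τ in Set.Ioi (0 : ℝ), ∫⁻ s in Set.Ioi (0 : ℝ),
          min (volume (superlevel g s)) (volume (superlevel H τ)) := by
        refine lintegral_lintegral_swap (Measurable.aemeasurable ?_)
        exact ((volume_superlevel_anti g).measurable.comp measurable_fst).min
          ((volume_superlevel_anti H).measurable.comp measurable_snd)
    _ ≤ ∫⁻ τ in Set.Ioi (0 : ℝ), ∫⁻ z in superlevel H τ, G z := by
        refine setLIntegral_mono' measurableSet_Ioi fun τ hτ => ?_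
        rw [setLIntegral_congr (hae τ hτ)]
        exact hgG.lintegral_min_le hg (hfin τ hτ)
    _ = _ := (lintegral_mul_eq_superlevel hH hG).symm

/-- Majorization is preserved by one step of a random walk. -/
theorem Majorized.step {g G h : E → ℝ≥0∞} (hgG : Majorized g G) (hh : Measurable h)
    (hg : Measurable g) (hG : Measurable G)
    (hf : ∀ t, 0 < t → volume (superlevel h t) ≠ ∞) :
    Majorized (fun x => ∫⁻ y, h y * g (x + y)) (fun x => ∫⁻ y, rearrange h y * G (x + y)) := by
  intro A hA hAf
  have hg' : Measurable fun p : E × E => g (p.1 + p.2) := hg.comp measurable_add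
  have hG' : Measurable fun p : E × E => G (p.1 + p.2) := hG.comp measurable_add
  rw [lintegral_lintegral_swap (f := fun x y => h y * g (x + y))
      ((hh.comp measurable_snd).mul hg').aemeasurable,
    lintegral_lintegral_swap (f := fun x y => rearrange h y * G (x + y))
      (((measurable_rearrange h).comp measurable_snd).mul hG').aemeasurable]
  have h1 : ∀ y, ∫⁻ x in A, h y * g (x + y) = h y * ∫⁻ x in A, g (x + y) := fun y =>
    lintegral_const_mul _ (hg'.comp measurable_prodMk_right)
  have h2 : ∀ y, ∫⁻ x in centeredBall E (volume A), rearrange h y * G (x + y)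
      = rearrange h y * ∫⁻ x in centeredBall E (volume A), G (x + y) := fun y =>
    lintegral_const_mul _ (hG'.comp measurable_prodMk_right)
  simp_rw [h1, h2]
  rw [lintegral_mul_eq_superlevel hh hg'.lintegral_prod_left',
    lintegral_rearrange_mul h hG'.lintegral_prod_left']
  refine setLIntegral_mono' measurableSet_Ioi fun t ht => ?_
  rw [lintegral_lintegral_swap (f := fun y x => g (x + y))
      (hg'.comp measurable_swap).aemeasurable,
    lintegral_lintegral_swap (f := fun y x => G (x + y)) (hG'.comp measurable_swap).aemeasurable]
  exact hgG.setLIntegral_add_le hg hG hA (measurableSet_superlevel hh t) hAf (hf t ht)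

end InnerProduct

section Walk

variable {E : Type*} [NormedAddCommGroup E] [InnerProductSpace ℝ E] [FiniteDimensional ℝ E]
  [MeasurableSpace E] [BorelSpace E]

/-- The expectation of `∏ l ≤ n, p l (X l)` along the random walk `X` started at `x` whose steps
have density `φ`. -/
noncomputable def walkIntegral (φ : E → ℝ≥0∞) : ℕ → (ℕ → E → ℝ≥0∞) → E → ℝ≥0∞
  | 0, p => p 0
  | n + 1, p => fun x => p 0 x * ∫⁻ y, φ y * walkIntegral φ n (fun l => p (l + 1)) (x + y)

theorem measurable_walkIntegral {φ : E → ℝ≥0∞} (hφ : Measurable φ) (n : ℕ) {p : ℕ → E → ℝ≥0∞}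
    (hp : ∀ l, Measurable (p l)) : Measurable (walkIntegral φ n p) := by
  induction n generalizing p with
  | zero => exact hp 0
  | succ n ih =>
    have h := ih fun l => hp (l + 1)
    exact (hp 0).mul (Measurable.lintegral_prod_right'
      (f := fun q : E × E => φ q.2 * walkIntegral φ n (fun l => p (l + 1)) (q.1 + q.2))
      ((hφ.comp measurable_snd).mul (h.comp measurable_add)))

theorem Majorized.prod_mul {ι : Type*} (s : Finset ι) {f : ι → E → ℝ≥0∞}
    (hf : ∀ i, Measurable (f i)) {g G : E → ℝ≥0∞} (hg : Measurable g) (hG : Measurable G)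
    (hgG : Majorized g G) :
    Majorized (fun x => (∏ i ∈ s, f i x) * g x) (fun x => (∏ i ∈ s, rearrange (f i) x) * G x) := by
  classical
  induction s using Finset.induction_on with
  | empty => simpa using hgG
  | insert i s hi ih =>
    simp_rw [Finset.prod_insert hi, mul_assoc]
    exact ih.mul (hf i) ((Finset.measurable_fun_prod s fun i _ => hf i).mul hg)
      ((Finset.measurable_fun_prod s fun i _ => measurable_rearrange (f i)).mul hG)

variable [Nontrivial E]

theorem majorized_walkIntegral {ι : Type*} {φ : E → ℝ≥0∞} (hφ : Measurable φ)
    (hφ' : ∀ t, 0 < t → volume (superlevel φ t) ≠ ∞) {f : ι → E → ℝ≥0∞}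
    (hf : ∀ i, Measurable (f i)) (n : ℕ) (s : ℕ → Finset ι) :
    Majorized (walkIntegral φ n fun l x => ∏ i ∈ s l, f i x)
      (walkIntegral (rearrange φ) n fun l x => ∏ i ∈ s l, rearrange (f i) x) := by
  induction n generalizing s with
  | zero =>
    simpa [walkIntegral] using
      Majorized.prod_mul (s 0) hf measurable_one measurable_one majorized_one
  | succ n ih =>
    have h := measurable_walkIntegral hφ n fun l =>
      Finset.measurable_fun_prod (s (l + 1)) fun i _ => hf i
    have h' := measurable_walkIntegral (measurable_rearrange φ) n fun l =>
      Finset.measurable_fun_prod (s (l + 1)) fun i _ => measurable_rearrange (f i)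
    refine Majorized.prod_mul (s 0) hf ?_ ?_ ((ih fun l => s (l + 1)).step hφ h h' hφ')
    · exact Measurable.lintegral_prod_right'
        (f := fun q : E × E => φ q.2 * walkIntegral φ n _ (q.1 + q.2))
        ((hφ.comp measurable_snd).mul (h.comp measurable_add))
    · exact Measurable.lintegral_prod_right'
        (f := fun q : E × E => rearrange φ q.2 * walkIntegral (rearrange φ) n _ (q.1 + q.2))
        (((measurable_rearrange φ).comp measurable_snd).mul (h'.comp measurable_add))

omit [Nontrivial E] in
theorem le_rearrange_zero {f : E → ℝ≥0∞} (hf : Continuous f) (x₀ : E) :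
    f x₀ ≤ rearrange f 0 := by
  rw [eq_lintegral_superlevel f x₀]
  refine lintegral_mono fun t => ?_
  by_cases hx : x₀ ∈ superlevel f t
  · have hpos : 0 < volume (superlevel f t) :=
      (isOpen_lt continuous_const hf).measure_pos volume ⟨x₀, hx⟩
    rw [Set.indicator_of_mem hx, Set.indicator_of_mem (by simpa [centeredBall] using hpos)]
    rfl
  · simp [hx]

theorem walkIntegral_le_rearrange {ι : Type*} {φ : E → ℝ≥0∞} (hφ : Measurable φ)
    (hφ' : ∀ t, 0 < t → volume (superlevel φ t) ≠ ∞) {f : ι → E → ℝ≥0∞}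
    (hf : ∀ i, Continuous (f i)) (n : ℕ) (s : ℕ → Finset ι) (x₀ : E) :
    walkIntegral φ (n + 1) (fun l x => ∏ i ∈ s l, f i x) x₀ ≤
      walkIntegral (rearrange φ) (n + 1) (fun l x => ∏ i ∈ s l, rearrange (f i) x) 0 := by
  have hfm i := (hf i).measurable
  refine mul_le_mul' (Finset.prod_le_prod' fun i _ => le_rearrange_zero (hf i) x₀) ?_
  simp_rw [zero_add]
  exact (majorized_walkIntegral hφ hφ' hfm n fun l => s (l + 1)).lintegral_mul_comp_add_le hφ
    (measurable_walkIntegral hφ n fun l => Finset.measurable_fun_prod _ fun i _ => hfm i)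
    (measurable_walkIntegral (measurable_rearrange φ) n fun l =>
      Finset.measurable_fun_prod _ fun i _ => measurable_rearrange (f i)) hφ' x₀

end Walk

section EuclideanSpace

variable {d : ℕ}

theorem partialSum_zero {K : ℕ} (x : Fin K → EuclideanSpace ℝ (Fin d)) : partialSum x 0 = 0 := by
  simp [partialSum]

theorem partialSum_cons_succ {K : ℕ} (y : EuclideanSpace ℝ (Fin d))
    (x : Fin K → EuclideanSpace ℝ (Fin d)) (l : ℕ) :
    partialSum (Fin.cons y x : Fin (K + 1) → EuclideanSpace ℝ (Fin d)) (l + 1)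
      = y + partialSum x l := by
  simp [partialSum, Fin.sum_univ_succ]

theorem measurable_partialSum {K : ℕ} (l : ℕ) :
    Measurable fun x : Fin K → EuclideanSpace ℝ (Fin d) => partialSum x l := by
  refine Finset.measurable_fun_sum _ fun j _ => ?_
  split_ifs
  · exact measurable_pi_apply j
  · exact measurable_const

theorem lintegral_prod_partialSum {φ : EuclideanSpace ℝ (Fin d) → ℝ≥0∞} (hφ : Measurable φ)
    (n : ℕ) {p : ℕ → EuclideanSpace ℝ (Fin d) → ℝ≥0∞} (hp : ∀ l, Measurable (p l))
    (x : EuclideanSpace ℝ (Fin d)) :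
    ∫⁻ y : Fin n → EuclideanSpace ℝ (Fin d),
      (∏ l ∈ Finset.range (n + 1), p l (x + partialSum y l)) * ∏ j, φ (y j) =
      walkIntegral φ n p x := by
  induction n generalizing p x with
  | zero => simp [partialSum_zero, walkIntegral, volume_pi]
  | succ n ih =>
    have hF : ∀ (m : ℕ) {p : ℕ → EuclideanSpace ℝ (Fin d) → ℝ≥0∞}, (∀ l, Measurable (p l)) →
        ∀ x, Measurable fun y : Fin m → EuclideanSpace ℝ (Fin d) =>
        (∏ l ∈ Finset.range (m + 1), p l (x + partialSum y l)) * ∏ j, φ (y j) := fun m p hp x =>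
      (Finset.measurable_fun_prod _ fun l _ =>
        (hp l).comp ((measurable_partialSum l).const_add x)).mul
        (Finset.measurable_fun_prod _ fun j _ => hφ.comp (measurable_pi_apply j))
    have he := (volume_preserving_piFinSuccAbove
      (fun _ : Fin (n + 1) => EuclideanSpace ℝ (Fin d)) 0).symm
    rw [← he.lintegral_comp (hF (n + 1) hp x)]
    refine (lintegral_prod _ ((hF (n + 1) hp x).comp he.measurable).aemeasurable).trans ?_
    have hp' := fun l => hp (l + 1)
    simp_rw [walkIntegral, ← ih hp']
    rw [← lintegral_const_mul]
    · refine lintegral_congr fun y => ?_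
      rw [← lintegral_const_mul _ (hF n hp' _), ← lintegral_const_mul _ ((hF n hp' _).const_mul _)]
      refine lintegral_congr fun z => ?_
      have hz : (MeasurableEquiv.piFinSuccAbove
          (fun _ : Fin (n + 1) => EuclideanSpace ℝ (Fin d)) 0).symm (y, z) = Fin.cons y z :=
        Fin.insertNth_zero' y z
      rw [Function.comp_apply, hz, Finset.prod_range_succ', Fin.prod_univ_succ]
      simp only [partialSum_cons_succ, partialSum_zero, add_zero, Fin.cons_zero, Fin.cons_succ,
        add_assoc]
      ring
    · simp_rw [ih hp']
      exact hφ.mul ((measurable_walkIntegral hφ n hp').comp (measurable_const_add x))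

theorem lintegral_prod_comp_partialSum {m K : ℕ} {φ : EuclideanSpace ℝ (Fin d) → ℝ≥0∞}
    (hφ : Measurable φ) {f : Fin m → EuclideanSpace ℝ (Fin d) → ℝ≥0∞} (hf : ∀ i, Measurable (f i))
    {k : Fin m → ℕ} (hk : ∀ i, k i ≤ K) (x : EuclideanSpace ℝ (Fin d)) :
    ∫⁻ y : Fin K → EuclideanSpace ℝ (Fin d),
      (∏ i, f i (x + partialSum y (k i))) * ∏ j, φ (y j) =
      walkIntegral φ K (fun l x => ∏ i with k i = l, f i x) x := by
  rw [← lintegral_prod_partialSum hφ K fun l => Finset.measurable_fun_prod _ fun i _ => hf i]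
  refine lintegral_congr fun y => ?_
  congr 1
  rw [← Finset.prod_fiberwise_of_maps_to (g := k) (t := Finset.range (K + 1))
    fun i _ => Finset.mem_range.2 (Nat.lt_succ_of_le (hk i))]
  refine Finset.prod_congr rfl fun l _ => Finset.prod_congr rfl fun i hi => ?_
  rw [(Finset.mem_filter.1 hi).2]

theorem ballStar_eq_centeredBall [NeZero d] {A : Set (EuclideanSpace ℝ (Fin d))}
    (hA : volume A ≠ ∞) : ballStar A = centeredBall _ (volume A) := by
  have h0 : volume (Metric.ball (0 : EuclideanSpace ℝ (Fin d)) 1) ≠ 0 :=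
    (Metric.measure_ball_pos volume _ one_pos).ne'
  have hf : volume (Metric.ball (0 : EuclideanSpace ℝ (Fin d)) 1) ≠ ∞ := measure_ball_lt_top.ne
  have hr : 0 ≤ symmRadius A := Real.rpow_nonneg ENNReal.toReal_nonneg _
  have hv : volume (Metric.ball (0 : EuclideanSpace ℝ (Fin d)) (symmRadius A)) = volume A := by
    rw [Measure.addHaar_ball _ _ hr, finrank_euclideanSpace_fin, symmRadius, ← Real.rpow_natCast,
      ← Real.rpow_mul ENNReal.toReal_nonneg, one_div_mul_cancel (NeZero.ne (d : ℝ)), Real.rpow_one,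
      ENNReal.ofReal_toReal (ENNReal.div_ne_top hA h0), ENNReal.div_mul_cancel h0 hf]
  rw [← hv, centeredBall_volume_ball hr, ballStar]

theorem superlevel_ofReal {X : Type*} (f : X → ℝ) {t : ℝ} (ht : 0 < t) :
    superlevel (fun x => ENNReal.ofReal (f x)) t = {x | t < f x} := by
  ext x
  exact ENNReal.ofReal_lt_ofReal_iff_of_nonneg ht.le

theorem symmRearrange_eq_rearrange [NeZero d] {f : EuclideanSpace ℝ (Fin d) → ℝ}
    (hf : VanishesAtInfinity f) :
    symmRearrange f = rearrange fun x => ENNReal.ofReal (f x) := by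
  ext x
  refine setLIntegral_congr_fun measurableSet_Ioi fun t ht => ?_
  simp only [superlevel_ofReal f ht, ballStar_eq_centeredBall (hf t ht).ne]
  rfl

end EuclideanSpace

/-- **Rearrangement inequality for random walks (continuous case, pointwise).** -/
theorem random_walk_rearrangement_continuous {d m : ℕ} (hd : 1 ≤ d) (hm : 1 ≤ m)
    (φ : EuclideanSpace ℝ (Fin d) → ℝ) (hφ_meas : Measurable φ)
    (hφ_nonneg : ∀ y, 0 ≤ φ y)
    (hφ_prob : ∫⁻ y, ENNReal.ofReal (φ y) = 1)
    (hφ_van : VanishesAtInfinity φ)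
    (f : Fin m → EuclideanSpace ℝ (Fin d) → ℝ)
    (hf_cont : ∀ i, Continuous (f i))
    (hf_nonneg : ∀ i x, 0 ≤ f i x)
    (hf_van : ∀ i, VanishesAtInfinity (f i))
    (k : Fin m → ℕ) (hk_mono : Monotone k)
    (K : ℕ) (hK : K = k ⟨m - 1, Nat.sub_lt hm Nat.one_pos⟩) (hK1 : 1 ≤ K)
    (x₀ : EuclideanSpace ℝ (Fin d)) :
    (∫⁻ x : Fin K → EuclideanSpace ℝ (Fin d),
        (∏ i, ENNReal.ofReal (f i (x₀ + partialSum x (k i)))) *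
          ∏ j, ENNReal.ofReal (φ (x j))) ≤
      ∫⁻ x : Fin K → EuclideanSpace ℝ (Fin d),
        (∏ i, symmRearrange (f i) (partialSum x (k i))) *
          ∏ j, symmRearrange φ (x j) := by
  have : NeZero d := ⟨by omega⟩
  have hk : ∀ i, k i ≤ K := fun i => hK ▸ hk_mono (Fin.mk_le_mk.2 (by omega) : i ≤ ⟨m - 1, _⟩)
  have hφ : Measurable fun y => ENNReal.ofReal (φ y) := hφ_meas.ennreal_ofReal
  have hf i : Continuous fun y => ENNReal.ofReal (f i y) :=
    ENNReal.continuous_ofReal.comp (hf_cont i)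
  have hR := lintegral_prod_comp_partialSum (measurable_rearrange fun y => ENNReal.ofReal (φ y))
    (fun i => measurable_rearrange fun y => ENNReal.ofReal (f i y)) hk 0
  simp_rw [zero_add] at hR
  simp_rw [symmRearrange_eq_rearrange hφ_van, fun i => symmRearrange_eq_rearrange (hf_van i)]
  rw [hR, lintegral_prod_comp_partialSum hφ (fun i => (hf i).measurable) hk]
  obtain ⟨n, rfl⟩ := Nat.exists_eq_add_of_le' hK1
  exact walkIntegral_le_rearrange hφ
    (fun t ht => by simpa only [superlevel_ofReal φ ht] using (hφ_van t ht).ne) hf n _ x₀
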